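/- Let κ be a perfect kernel on X, f an external field, and A ⊆ X a set such that E⁺(A) is closed in the strong metric d, cap_*(A) < ∞, and w_f(A) < ∞. Then there exists a unique solution λ = λ_{A,f} ∈ Ĕ⁺_f(A) of the inner Gauss variational problem for (A, f), i.e. I_f(λ) = w_f(A). Moreover, the constant c_{A,f} := ∫ U_f^λ dλ = w_f(A) − ∫ f dλ is finite, and λ is the unique measure μ ∈ Ĕ⁺_f(A) satisfying U_f^μ ≥ ∫ U_f^μ dμ n.e. on A, and also the unique measure μ ∈ Ĕ⁺_f(A) satisfying U_f^μ ≤ w_f(A) − ∫ f dμ μ-a.e. on X. -/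

import Mathlib

open MeasureTheory Topology Filter Set ENNReal

noncomputable section

namespace GaussVar

variable {X : Type*} [TopologicalSpace X] [MeasurableSpace X]

/-- A (positive) Radon measure: a regular Borel measure. -/
def IsRadon (μ : Measure X) : Prop := μ.Regular

/-- The mutual energy `I(μ,ν) = ∬ κ(x,y) d(μ⊗ν)(x,y)`. -/
def mutualEnergy (κ : X → X → ℝ≥0∞) (μ ν : Measure X) : ℝ≥0∞ :=
  ∫⁻ p : X × X, κ p.1 p.2 ∂(μ.prod ν)

/-- The energy `I(μ) := I(μ,μ)`. -/
def energy (κ : X → X → ℝ≥0∞) (μ : Measure X) : ℝ≥0∞ := mutualEnergy κ μ μ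

/-- Membership in the cone `E⁺` of Radon measures with finite energy. -/
def memEplus (κ : X → X → ℝ≥0∞) (μ : Measure X) : Prop :=
  IsRadon μ ∧ energy κ μ < ⊤

/-- A kernel: symmetric and lower semicontinuous with values in `[0,∞]`. -/
def IsKernel (κ : X → X → ℝ≥0∞) : Prop :=
  (∀ x y, κ x y = κ y x) ∧ LowerSemicontinuous (fun p : X × X => κ p.1 p.2)

/-- The strong (energy) metric `d(μ,ν) := (I(μ)+I(ν)−2I(μ,ν))^{1/2}` on `E⁺`. -/
def strongDist (κ : X → X → ℝ≥0∞) (μ ν : Measure X) : ℝ :=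
  Real.sqrt ((energy κ μ).toReal + (energy κ ν).toReal - 2 * (mutualEnergy κ μ ν).toReal)

/-- The energy principle (strict positive definiteness). -/
def EnergyPrinciple (κ : X → X → ℝ≥0∞) : Prop :=
  ∀ μ ν : Measure X, memEplus κ μ → memEplus κ ν →
    2 * mutualEnergy κ μ ν ≤ energy κ μ + energy κ ν ∧
      (2 * mutualEnergy κ μ ν = energy κ μ + energy κ ν → μ = ν)

/-- Convergence of a sequence in the strong metric. -/
def StrongTendstoSeq (κ : X → X → ℝ≥0∞) (μ : ℕ → Measure X) (μ₀ : Measure X) : Prop :=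
  Tendsto (fun n => strongDist κ (μ n) μ₀) atTop (𝓝 0)

/-- Vague convergence of a sequence of measures. -/
def VagueTendstoSeq (μ : ℕ → Measure X) (μ₀ : Measure X) : Prop :=
  ∀ φ : X → ℝ, Continuous φ → HasCompactSupport φ →
    Tendsto (fun n => ∫ x, φ x ∂(μ n)) atTop (𝓝 (∫ x, φ x ∂μ₀))

/-- Cauchy sequence in the strong metric. -/
def StrongCauchySeq (κ : X → X → ℝ≥0∞) (μ : ℕ → Measure X) : Prop :=
  ∀ ε : ℝ, 0 < ε → ∃ N : ℕ, ∀ m ≥ N, ∀ n ≥ N, strongDist κ (μ m) (μ n) < ε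

/-- A perfect kernel: satisfies the energy principle, `(E⁺,d)` is complete, and
strong convergence implies vague convergence. -/
def IsPerfect (κ : X → X → ℝ≥0∞) : Prop :=
  EnergyPrinciple κ ∧
    (∀ μ : ℕ → Measure X, (∀ n, memEplus κ (μ n)) → StrongCauchySeq κ μ →
        ∃ μ₀ : Measure X, memEplus κ μ₀ ∧ StrongTendstoSeq κ μ μ₀) ∧
    (∀ (μ : ℕ → Measure X) (μ₀ : Measure X), (∀ n, memEplus κ (μ n)) → memEplus κ μ₀ →
        StrongTendstoSeq κ μ μ₀ → VagueTendstoSeq μ μ₀)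

/-- `μ` is concentrated on `A`: the complement of `A` is locally `μ`-negligible. -/
def Concentrated (μ : Measure X) (A : Set X) : Prop :=
  ∀ K : Set X, IsCompact K → μ (Aᶜ ∩ K) = 0

/-- Membership in `Ĕ⁺(A)`: finite-energy Radon measures concentrated on `A`
of unit total mass. -/
def memBreve (κ : X → X → ℝ≥0∞) (A : Set X) (μ : Measure X) : Prop :=
  memEplus κ μ ∧ Concentrated μ A ∧ μ Set.univ = 1

/-- `w(A) := inf { I(μ) : μ ∈ Ĕ⁺(A) }` (with `inf ∅ = ⊤`). -/
def wcap (κ : X → X → ℝ≥0∞) (A : Set X) : ℝ≥0∞ :=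
  ⨅ (μ : Measure X) (_ : memBreve κ A μ), energy κ μ

/-- The inner capacity `cap_*(A) := 1 / w(A)`. -/
def innerCap (κ : X → X → ℝ≥0∞) (A : Set X) : ℝ≥0∞ := (wcap κ A)⁻¹

/-- The outer capacity `cap^*(E) := inf { cap_*(D) : D open, E ⊆ D }`. -/
def outerCap (κ : X → X → ℝ≥0∞) (E : Set X) : ℝ≥0∞ :=
  ⨅ (D : Set X) (_ : IsOpen D ∧ E ⊆ D), innerCap κ D

/-- `P` holds nearly everywhere (n.e.) on `A`: the exceptional subset of `A`
has inner capacity zero. -/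
def NearlyEverywhere (κ : X → X → ℝ≥0∞) (A : Set X) (P : X → Prop) : Prop :=
  innerCap κ {x ∈ A | ¬ P x} = 0

/-- The potential `U^μ(x) := ∫ κ(x,y) dμ(y)`. -/
def potential (κ : X → X → ℝ≥0∞) (μ : Measure X) (x : X) : ℝ≥0∞ :=
  ∫⁻ y, κ x y ∂μ

/-- An external field: `f = ψ + U^{ϑ⁺} − U^{ϑ⁻}` where `ψ` is lower semicontinuous,
`(−∞,∞]`-valued, positive if `X` is noncompact, and `ϑ⁺, ϑ⁻ ∈ E⁺`. -/
def IsExternalField (κ : X → X → ℝ≥0∞) (f : X → EReal) : Prop :=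
  ∃ (ψ : X → EReal) (ϑp ϑm : Measure X),
    LowerSemicontinuous ψ ∧ (∀ x, ψ x ≠ ⊥) ∧ (¬ CompactSpace X → ∀ x, 0 ≤ ψ x) ∧
    memEplus κ ϑp ∧ memEplus κ ϑm ∧
    ∀ x, f x = ψ x + (potential κ ϑp x : EReal) - (potential κ ϑm x : EReal)

/-- `f` is `μ`-integrable (as an extended-real-valued function). -/
def FieldIntegrable (f : X → EReal) (μ : Measure X) : Prop :=
  Integrable (fun x => (f x).toReal) μ ∧ (∀ᵐ x ∂μ, f x ≠ ⊤ ∧ f x ≠ ⊥)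

/-- `∫ f dμ` for an a.e.-finite integrable field. -/
def fieldIntegral (f : X → EReal) (μ : Measure X) : ℝ := ∫ x, (f x).toReal ∂μ

/-- The Gauss functional `I_f(μ) := I(μ) + 2 ∫ f dμ`. -/
def gaussI (κ : X → X → ℝ≥0∞) (f : X → EReal) (μ : Measure X) : ℝ :=
  (energy κ μ).toReal + 2 * fieldIntegral f μ

/-- Membership in `Ĕ⁺_f(A)`. -/
def Admissible (κ : X → X → ℝ≥0∞) (A : Set X) (f : X → EReal) (μ : Measure X) : Prop :=
  memBreve κ A μ ∧ FieldIntegrable f μ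

/-- `w_f(A) := inf { I_f(μ) : μ ∈ Ĕ⁺_f(A) }` (with `inf ∅ = ⊤`). -/
def wf (κ : X → X → ℝ≥0∞) (A : Set X) (f : X → EReal) : EReal :=
  ⨅ (μ : Measure X) (_ : Admissible κ A f μ), ((gaussI κ f μ : ℝ) : EReal)

/-- `l` is a solution of the inner Gauss variational problem for `(A,f)`. -/
def IsSolution (κ : X → X → ℝ≥0∞) (A : Set X) (f : X → EReal) (l : Measure X) : Prop :=
  Admissible κ A f l ∧ ((gaussI κ f l : ℝ) : EReal) = wf κ A f

/-- The `f`-weighted potential `U_f^μ := U^μ + f`. -/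
def wPotential (κ : X → X → ℝ≥0∞) (f : X → EReal) (μ : Measure X) (x : X) : EReal :=
  (potential κ μ x : EReal) + f x

/-- `∫ U_f^μ dμ`, the weighted equilibrium constant of a solution. -/
def wConst (κ : X → X → ℝ≥0∞) (f : X → EReal) (μ : Measure X) : ℝ :=
  ∫ x, (wPotential κ f μ x).toReal ∂μ

/-- The cone `E⁺(A)` is closed in the strong metric. -/
def StrongClosedEplusOn (κ : X → X → ℝ≥0∞) (A : Set X) : Prop :=
  ∀ (μ : ℕ → Measure X) (μ₀ : Measure X),
    (∀ n, memEplus κ (μ n) ∧ Concentrated (μ n) A) →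
    memEplus κ μ₀ → StrongTendstoSeq κ μ μ₀ → Concentrated μ₀ A

/-- Frostman's (first) maximum principle. -/
def FrostmanMax (κ : X → X → ℝ≥0∞) : Prop :=
  ∀ μ : Measure X, memEplus κ μ →
    (∀ x : X, (∀ U : Set X, IsOpen U → x ∈ U → 0 < μ U) → potential κ μ x ≤ 1) →
    ∀ x : X, potential κ μ x ≤ 1

/-- The domination (second maximum) principle. -/
def DominationPrinciple (κ : X → X → ℝ≥0∞) : Prop :=
  ∀ μ ν : Measure X, memEplus κ μ → memEplus κ ν →
    (∀ᵐ x ∂μ, potential κ μ x ≤ potential κ ν x) →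
    ∀ x : X, potential κ μ x ≤ potential κ ν x

/-- `β` is the inner balayage of `ζ` onto `A`: `β ∈ E⁺(A)` and `U^β = U^ζ` n.e. on `A`. -/
def IsInnerBalayage (κ : X → X → ℝ≥0∞) (A : Set X) (ζ β : Measure X) : Prop :=
  memEplus κ β ∧ Concentrated β A ∧
    NearlyEverywhere κ A (fun x => potential κ β x = potential κ ζ x)

/-- `γ` is the inner capacitary measure of `A`: `γ ∈ E⁺(A)` and `U^γ = 1` n.e. on `A`. -/
def IsCapacitaryMeasure (κ : X → X → ℝ≥0∞) (A : Set X) (γ : Measure X) : Prop :=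
  memEplus κ γ ∧ Concentrated γ A ∧
    NearlyEverywhere κ A (fun x => potential κ γ x = 1)

/-- `A` is quasiclosed: approximable in outer capacity by closed sets. -/
def Quasiclosed (κ : X → X → ℝ≥0∞) (A : Set X) : Prop :=
  ∀ ε : ℝ≥0∞, 0 < ε → ∃ F : Set X, IsClosed F ∧ outerCap κ (symmDiff A F) < ε

/-- `A` is quasicompact: approximable in outer capacity by compact sets. -/
def Quasicompact (κ : X → X → ℝ≥0∞) (A : Set X) : Prop :=
  ∀ ε : ℝ≥0∞, 0 < ε → ∃ K : Set X, IsCompact K ∧ outerCap κ (symmDiff A K) < ε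

set_option linter.unusedSectionVars false

/-- The step function of mesh `a` with `N` steps below a level `t`. -/
def stepSum (a : ℝ≥0∞) (N : ℕ) (t : ℝ≥0∞) : ℝ≥0∞ :=
  ∑ k ∈ Finset.range N, (if ((k : ℝ≥0∞) + 1) * a < t then a else 0)

lemma stepSum_le_aux (a t : ℝ≥0∞) (N : ℕ) : stepSum a N t ≤ N * a ∧ stepSum a N t ≤ t := by
  induction N with
  | zero => simp [stepSum]
  | succ n ih =>
    have h1 : stepSum a (n+1) t = stepSum a n t + (if ((n : ℝ≥0∞) + 1) * a < t then a else 0) := by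
      simp [stepSum, Finset.sum_range_succ]
    have h2 : stepSum a (n+1) t ≤ ((n+1 : ℕ) : ℝ≥0∞) * a := by
      rw [h1]
      push_cast
      rw [add_mul, one_mul]
      refine add_le_add ih.1 ?_
      split_ifs <;> simp
    refine ⟨h2, ?_⟩
    by_cases h : ((n : ℝ≥0∞) + 1) * a < t
    · refine h2.trans ?_
      push_cast
      exact h.le
    · rw [h1, if_neg h, add_zero]
      exact ih.2

lemma stepSum_le (a t : ℝ≥0∞) (N : ℕ) : stepSum a N t ≤ t := (stepSum_le_aux a t N).2

lemma le_stepSum (a t : ℝ≥0∞) (N M : ℕ) (hM : M ≤ N) (h : M * a < t) :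
    M * a ≤ stepSum a N t := by
  have h1 : ∑ k ∈ Finset.range M, (if ((k : ℝ≥0∞) + 1) * a < t then a else 0)
      = ∑ k ∈ Finset.range M, a := by
    refine Finset.sum_congr rfl fun k hk => ?_
    rw [if_pos]
    refine lt_of_le_of_lt ?_ h
    gcongr
    have := Finset.mem_range.1 hk
    exact_mod_cast this
  have h2 : (M : ℝ≥0∞) * a = ∑ k ∈ Finset.range M, a := by simp
  rw [h2, ← h1]
  exact Finset.sum_le_sum_of_subset (by simpa using hM)

lemma le_liminf_stepSum (t : ℝ≥0∞) :
    t ≤ liminf (fun n : ℕ => stepSum (((n : ℝ≥0∞) + 1)⁻¹) ((n + 1) ^ 2) t) atTop := by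
  refine le_of_forall_lt fun c hc => ?_
  obtain ⟨d, hcd, hdt⟩ := exists_between hc
  have hd : d ≠ ⊤ := (hdt.trans_le le_top).ne
  lift d to NNReal using hd
  have hc' : c ≠ ⊤ := (hcd.trans_le le_top).ne
  lift c to NNReal using hc'
  obtain ⟨e, hce, hed⟩ := exists_between hcd
  refine lt_of_lt_of_le hce ?_
  have he' : e ≠ ⊤ := (hed.trans_le le_top).ne
  lift e to NNReal using he'
  refine le_liminf_of_le (by isBoundedDefault) ?_
  have hed' : (e : ℝ) < d := by exact_mod_cast hed
  have hev : ∀ᶠ n : ℕ in atTop, (1 / ((n : ℝ) + 1) < (d : ℝ) - e ∧ (d : ℝ) ≤ n) :=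
    (tendsto_one_div_add_atTop_nhds_zero_nat.eventually_lt_const (sub_pos.2 hed')).and
      (tendsto_natCast_atTop_atTop.eventually_ge_atTop _)
  filter_upwards [hev] with n hn
  set M := ⌊(d : ℝ) * (n + 1)⌋₊ with hM
  have hpos : (0 : ℝ) < n + 1 := by positivity
  have hMle : (M : ℝ) ≤ d * (n + 1) := Nat.floor_le (by positivity)
  have hMge : (d : ℝ) * (n + 1) < M + 1 := Nat.lt_floor_add_one _
  have hcoe : (M : ℝ≥0∞) * ((n : ℝ≥0∞) + 1)⁻¹ = ENNReal.ofReal ((M : ℝ) / (n + 1)) := by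
    rw [ENNReal.ofReal_div_of_pos hpos, div_eq_mul_inv, ENNReal.ofReal_natCast,
      ENNReal.ofReal_add (by positivity) (by positivity)]
    simp
  refine le_trans ?_ (le_stepSum _ t _ M ?_ ?_)
  · rw [hcoe, ← ENNReal.ofReal_coe_nnreal]
    refine ENNReal.ofReal_le_ofReal ?_
    rw [le_div_iff₀ hpos]
    have := hn.1
    rw [div_lt_iff₀ hpos] at this
    nlinarith
  · have : (M : ℝ) ≤ ((n + 1) ^ 2 : ℕ) := by
      push_cast
      nlinarith [hn.2]
    exact_mod_cast this
  · refine lt_of_le_of_lt ?_ hdt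
    rw [hcoe, ← ENNReal.ofReal_coe_nnreal]
    refine ENNReal.ofReal_le_ofReal ?_
    rw [div_le_iff₀ hpos]
    exact hMle

lemma lintegral_stepSum (μ : Measure X) {g : X → ℝ≥0∞} (hg : Measurable g) (a : ℝ≥0∞) (N : ℕ) :
    ∫⁻ x, stepSum a N (g x) ∂μ
      = ∑ k ∈ Finset.range N, a * μ {x | ((k : ℝ≥0∞) + 1) * a < g x} := by
  have hm : ∀ k : ℕ, MeasurableSet {x | ((k : ℝ≥0∞) + 1) * a < g x} := fun k =>
    measurableSet_lt measurable_const hg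
  simp only [stepSum]
  rw [lintegral_finsetSum]
  · refine Finset.sum_congr rfl fun k _ => ?_
    rw [← lintegral_indicator_const (hm k)]
    exact lintegral_congr fun x => by simp [indicator_apply]
  · intro k _
    exact Measurable.ite (hm k) measurable_const measurable_const

lemma measurable_stepSum {g : X → ℝ≥0∞} (hg : Measurable g) (a : ℝ≥0∞) (N : ℕ) :
    Measurable fun x => stepSum a N (g x) := by
  refine Finset.measurable_sum _ fun k _ => ?_
  exact Measurable.ite (measurableSet_lt measurable_const hg) measurable_const measurable_const

lemma exists_lt_sum_of_lt_lintegral (μ : Measure X) {g : X → ℝ≥0∞} (hg : Measurable g)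
    {c : ℝ≥0∞} (hc : c < ∫⁻ x, g x ∂μ) :
    ∃ (a : ℝ≥0∞) (N : ℕ), c < ∑ k ∈ Finset.range N, a * μ {x | ((k : ℝ≥0∞) + 1) * a < g x} := by
  have h1 : ∫⁻ x, g x ∂μ ≤
      liminf (fun n : ℕ => ∫⁻ x, stepSum (((n : ℝ≥0∞) + 1)⁻¹) ((n + 1) ^ 2) (g x) ∂μ) atTop :=
    (lintegral_mono fun x => le_liminf_stepSum (g x)).trans
      (lintegral_liminf_le fun n => measurable_stepSum hg _ _)
  obtain ⟨n, hn⟩ := (eventually_lt_of_lt_liminf (hc.trans_le h1)).exists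
  exact ⟨_, _, by rwa [lintegral_stepSum μ hg] at hn⟩

lemma sum_mul_measure_le_lintegral (μ : Measure X) {g : X → ℝ≥0∞} (hg : Measurable g)
    (a : ℝ≥0∞) (N : ℕ) :
    ∑ k ∈ Finset.range N, a * μ {x | ((k : ℝ≥0∞) + 1) * a < g x} ≤ ∫⁻ x, g x ∂μ := by
  rw [← lintegral_stepSum μ hg]
  exact lintegral_mono fun x => stepSum_le _ _ _

/-- On open sets, regular measures commute with directed unions. -/
lemma measure_iUnion_of_directed_isOpen (μ : Measure X) [μ.Regular] {ι : Type*} [Nonempty ι]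
    {s : ι → Set X} (hs : ∀ i, IsOpen (s i)) (hd : Directed (· ⊆ ·) s) :
    μ (⋃ i, s i) = ⨆ i, μ (s i) := by
  refine le_antisymm ?_ (iSup_le fun i => measure_mono (subset_iUnion s i))
  rw [(isOpen_iUnion hs).measure_eq_iSup_isCompact μ]
  refine iSup_le fun K => iSup_le fun hK => iSup_le fun hKc => ?_
  obtain ⟨i, hi⟩ := hKc.elim_directed_cover s hs hK hd
  exact (measure_mono hi).trans (le_iSup (fun i => μ (s i)) i)

/-- Monotone convergence for directed families of lower semicontinuous functions. -/
lemma lintegral_iSup_of_directed_lowerSemicontinuous [BorelSpace X] (μ : Measure X) [μ.Regular]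
    {ι : Type*} [Nonempty ι] {g : ι → X → ℝ≥0∞} (hg : ∀ i, LowerSemicontinuous (g i))
    (hd : Directed (· ≤ ·) g) :
    ∫⁻ x, ⨆ i, g i x ∂μ = ⨆ i, ∫⁻ x, g i x ∂μ := by
  refine le_antisymm ?_ (iSup_le fun i => lintegral_mono fun x => le_iSup (fun i => g i x) i)
  refine le_of_forall_lt fun c hc => ?_
  have hmeas : Measurable fun x => ⨆ i, g i x := (lowerSemicontinuous_iSup hg).measurable
  obtain ⟨a, N, h⟩ := exists_lt_sum_of_lt_lintegral μ hmeas hc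
  have h1 : ∀ k : ℕ, a * μ {x | ((k : ℝ≥0∞) + 1) * a < ⨆ i, g i x}
      = ⨆ i, a * μ {x | ((k : ℝ≥0∞) + 1) * a < g i x} := by
    intro k
    rw [← ENNReal.mul_iSup, ← measure_iUnion_of_directed_isOpen μ
      (s := fun i => {x | ((k : ℝ≥0∞) + 1) * a < g i x}) (fun i => (hg i).isOpen_preimage _)]
    · congr 2
      ext x
      simp [lt_iSup_iff]
    · intro i j
      obtain ⟨l, hl, hl'⟩ := hd i j
      exact ⟨l, fun x hx => lt_of_lt_of_le hx (hl x), fun x hx => lt_of_lt_of_le hx (hl' x)⟩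
  simp_rw [h1] at h
  rw [ENNReal.finsetSum_iSup] at h
  · obtain ⟨i, hi⟩ := lt_iSup_iff.1 h
    exact hi.trans_le ((sum_mul_measure_le_lintegral μ (hg i).measurable a N).trans
      (le_iSup (fun i => ∫⁻ x, g i x ∂μ) i))
  · intro i j
    obtain ⟨l, hl, hl'⟩ := hd i j
    refine ⟨l, fun k => ⟨?_, ?_⟩⟩
    · gcongr with x; exact hl x
    · gcongr with x; exact hl' x

lemma liminf_add_liminf_le {α : Type*} (u v : α → ℝ≥0∞) (l : Filter α) :
    liminf u l + liminf v l ≤ liminf (fun n => u n + v n) l := by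
  refine le_of_forall_lt fun c hc => ?_
  by_cases hu : liminf u l = 0
  · rw [hu, zero_add] at hc
    exact hc.trans_le (liminf_le_liminf (Eventually.of_forall fun n => le_add_self))
  by_cases hv : liminf v l = 0
  · rw [hv, add_zero] at hc
    exact hc.trans_le (liminf_le_liminf (Eventually.of_forall fun n => le_self_add))
  obtain ⟨a, ha, b, hb, hab⟩ := ENNReal.exists_lt_add_of_lt_add hc hu hv
  refine hab.trans_le (le_liminf_of_le (by isBoundedDefault) ?_)
  filter_upwards [eventually_lt_of_lt_liminf ha, eventually_lt_of_lt_liminf hb] with n h1 h2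
  exact add_le_add h1.le h2.le

lemma sum_liminf_le {ι α : Type*} (s : Finset ι) (u : ι → α → ℝ≥0∞) (l : Filter α) :
    ∑ i ∈ s, liminf (u i) l ≤ liminf (fun n => ∑ i ∈ s, u i n) l := by
  classical
  induction s using Finset.induction_on with
  | empty => simp
  | insert i s hi ih =>
    simp only [Finset.sum_insert hi]
    exact (add_le_add le_rfl ih).trans (liminf_add_liminf_le _ _ _)

/-- Lower semicontinuity of `μ ↦ ∫ g dμ` for lower semicontinuous `g`, from that on open sets. -/
lemma lintegral_le_liminf_of_lowerSemicontinuous [BorelSpace X] {μ : ℕ → Measure X}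
    {μ₀ : Measure X} (h : ∀ V : Set X, IsOpen V → μ₀ V ≤ liminf (fun n => μ n V) atTop)
    {g : X → ℝ≥0∞} (hg : LowerSemicontinuous g) :
    ∫⁻ x, g x ∂μ₀ ≤ liminf (fun n => ∫⁻ x, g x ∂(μ n)) atTop := by
  refine le_of_forall_lt fun c hc => ?_
  obtain ⟨a, N, ha⟩ := exists_lt_sum_of_lt_lintegral μ₀ hg.measurable hc
  refine ha.trans_le ?_
  calc ∑ k ∈ Finset.range N, a * μ₀ {x | ((k : ℝ≥0∞) + 1) * a < g x}
      ≤ ∑ k ∈ Finset.range N, liminf (fun n => a * μ n {x | ((k : ℝ≥0∞) + 1) * a < g x}) atTop := by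
        refine Finset.sum_le_sum fun k _ => ?_
        have h1 : ∀ c : ℝ≥0∞, liminf (fun _ : ℕ => c) atTop = c := fun c => liminf_const c
        refine (mul_le_mul_right (h _ (hg.isOpen_preimage _)) a).trans ?_
        refine (mul_le_mul_left (h1 a).ge _).trans ?_
        exact ENNReal.le_liminf_mul
    _ ≤ liminf (fun n => ∑ k ∈ Finset.range N, a * μ n {x | ((k : ℝ≥0∞) + 1) * a < g x}) atTop :=
        sum_liminf_le _ _ _
    _ ≤ _ := liminf_le_liminf (Eventually.of_forall fun n =>
        sum_mul_measure_le_lintegral (μ n) hg.measurable a N)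

/-- Open rectangles weighted by a constant lying below the kernel. -/
abbrev Rect (κ : X → X → ℝ≥0∞) : Type _ :=
  {t : ℝ≥0∞ × Set X × Set X //
    IsOpen t.2.1 ∧ IsOpen t.2.2 ∧ ∀ x ∈ t.2.1, ∀ y ∈ t.2.2, t.1 ≤ κ x y}

open scoped Classical in
/-- Maximum of finitely many weighted rectangle indicators below the kernel. -/
def rectSup (κ : X → X → ℝ≥0∞) (F : Finset (Rect κ)) (x y : X) : ℝ≥0∞ :=
  F.sup fun t => if x ∈ t.1.2.1 ∧ y ∈ t.1.2.2 then t.1.1 else 0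

lemma rectSup_mono (κ : X → X → ℝ≥0∞) {F G : Finset (Rect κ)} (h : F ⊆ G) (x y : X) :
    rectSup κ F x y ≤ rectSup κ G x y := Finset.sup_mono h

lemma iSup_rectSup {κ : X → X → ℝ≥0∞} (hκ : IsKernel κ) (x y : X) :
    ⨆ F, rectSup κ F x y = κ x y := by
  classical
  refine le_antisymm (iSup_le fun F => Finset.sup_le fun t _ => ?_) (le_of_forall_lt fun c hc => ?_)
  · split_ifs with h
    · exact t.2.2.2 x h.1 y h.2
    · exact zero_le
  · obtain ⟨d, hcd, hd⟩ := exists_between hc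
    obtain ⟨U, V, hU, hxU, hV, hyV, h⟩ := mem_nhds_prod_iff'.1 (hκ.2 (x, y) d hd)
    let t : Rect κ := ⟨(d, U, V), hU, hV, fun a ha b hb => (le_of_lt (h (Set.mk_mem_prod ha hb)))⟩
    refine hcd.trans_le ?_
    refine le_trans ?_ (le_iSup _ {t})
    simp [rectSup, t, hxU, hyV]

lemma measurable_rectSup [OpensMeasurableSpace X] (κ : X → X → ℝ≥0∞) (F : Finset (Rect κ)) :
    Measurable fun p : X × X => rectSup κ F p.1 p.2 := by
  classical
  unfold rectSup
  induction F using Finset.induction_on with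
  | empty => simp
  | insert t F _ ih =>
    simp only [Finset.sup_insert]
    refine Measurable.sup (Measurable.ite ?_ measurable_const measurable_const) ih
    exact t.2.1.measurableSet.prod t.2.2.1.measurableSet

lemma lowerSemicontinuous_rectSup_right (κ : X → X → ℝ≥0∞) (F : Finset (Rect κ)) (x : X) :
    LowerSemicontinuous (rectSup κ F x) := by
  intro y c hc
  obtain ⟨t, ht, hct⟩ := (Finset.lt_sup_iff).1 hc
  split_ifs at hct with h
  · filter_upwards [t.2.2.1.mem_nhds h.2] with z hz
    refine hct.trans_le (le_trans ?_ (Finset.le_sup ht))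
    rw [if_pos ⟨h.1, hz⟩]
  · exact absurd hct (by simp)

lemma eventually_rectSup_le (κ : X → X → ℝ≥0∞) (F : Finset (Rect κ)) (x₀ : X) :
    ∀ᶠ x in 𝓝 x₀, ∀ y, rectSup κ F x₀ y ≤ rectSup κ F x y := by
  have h : ∀ᶠ x in 𝓝 x₀, ∀ t ∈ F, x₀ ∈ t.1.2.1 → x ∈ t.1.2.1 := by
    rw [Filter.eventually_all_finset]
    intro t _
    by_cases h : x₀ ∈ t.1.2.1
    · filter_upwards [t.2.1.mem_nhds h] with x hx _ using hx
    · exact Eventually.of_forall fun x hx => absurd hx h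
  filter_upwards [h] with x hx y
  refine Finset.sup_mono_fun fun t ht => ?_
  split_ifs with h1 h2 h2
  · exact le_rfl
  · exact absurd ⟨hx t ht h1.1, h1.2⟩ h2
  · exact zero_le
  · exact le_rfl

lemma potential_eq_iSup [BorelSpace X] {κ : X → X → ℝ≥0∞} (hκ : IsKernel κ) (μ : Measure X)
    [μ.Regular] (x : X) : potential κ μ x = ⨆ F, ∫⁻ y, rectSup κ F x y ∂μ := by
  classical
  rw [← lintegral_iSup_of_directed_lowerSemicontinuous μ
    (fun F => lowerSemicontinuous_rectSup_right κ F x)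
    (fun F G => ⟨F ∪ G, fun y => rectSup_mono κ Finset.subset_union_left x y,
      fun y => rectSup_mono κ Finset.subset_union_right x y⟩)]
  exact lintegral_congr fun y => (iSup_rectSup hκ x y).symm

lemma lowerSemicontinuous_lintegral_rectSup (κ : X → X → ℝ≥0∞) (μ : Measure X)
    (F : Finset (Rect κ)) : LowerSemicontinuous fun x => ∫⁻ y, rectSup κ F x y ∂μ := by
  intro x c hc
  filter_upwards [eventually_rectSup_le κ F x] with z hz
  exact hc.trans_le (lintegral_mono hz)

lemma lowerSemicontinuous_potential [BorelSpace X] {κ : X → X → ℝ≥0∞} (hκ : IsKernel κ)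
    (μ : Measure X) [μ.Regular] : LowerSemicontinuous (potential κ μ) := by
  have h : potential κ μ = fun x => ⨆ F, ∫⁻ y, rectSup κ F x y ∂μ :=
    funext (potential_eq_iSup hκ μ)
  rw [h]
  exact lowerSemicontinuous_iSup fun F => lowerSemicontinuous_lintegral_rectSup κ μ F

lemma mutualEnergy_eq_lintegral_potential [BorelSpace X] {κ : X → X → ℝ≥0∞} (hκ : IsKernel κ)
    (μ ν : Measure X) [μ.Regular] [ν.Regular] [SFinite ν] :
    mutualEnergy κ μ ν = ∫⁻ x, potential κ ν x ∂μ := by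
  classical
  refine le_antisymm (lintegral_prod_le _) ?_
  simp_rw [potential_eq_iSup hκ ν]
  rw [lintegral_iSup_of_directed_lowerSemicontinuous μ
    (fun F => lowerSemicontinuous_lintegral_rectSup κ ν F)
    (fun F G => ⟨F ∪ G,
      fun x => lintegral_mono fun y => rectSup_mono κ Finset.subset_union_left x y,
      fun x => lintegral_mono fun y => rectSup_mono κ Finset.subset_union_right x y⟩)]
  refine iSup_le fun F => ?_
  rw [← lintegral_prod (fun p : X × X => rectSup κ F p.1 p.2)
    (measurable_rectSup κ F).aemeasurable]
  exact lintegral_mono fun p => (le_iSup (fun F => rectSup κ F p.1 p.2) F).trans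
    (iSup_rectSup hκ p.1 p.2).le

lemma mutualEnergy_comm {κ : X → X → ℝ≥0∞} (hκ : IsKernel κ) (μ ν : Measure X) [SFinite μ]
    [SFinite ν] : mutualEnergy κ μ ν = mutualEnergy κ ν μ := by
  unfold mutualEnergy
  rw [← lintegral_prod_swap]
  exact lintegral_congr fun p => hκ.1 _ _

/-- Finite Radon measures of finite energy. -/
def FiniteEplus (κ : X → X → ℝ≥0∞) (μ : Measure X) : Prop :=
  IsFiniteMeasure μ ∧ memEplus κ μ

/-- The mutual energy as a real number. -/
def realEnergy (κ : X → X → ℝ≥0∞) (μ ν : Measure X) : ℝ := (mutualEnergy κ μ ν).toReal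

lemma strongDist_eq (κ : X → X → ℝ≥0∞) (μ ν : Measure X) :
    strongDist κ μ ν = √(realEnergy κ μ μ + realEnergy κ ν ν - 2 * realEnergy κ μ ν) := rfl

lemma realEnergy_nonneg (κ : X → X → ℝ≥0∞) (μ ν : Measure X) : 0 ≤ realEnergy κ μ ν :=
  ENNReal.toReal_nonneg

lemma strongDist_nonneg (κ : X → X → ℝ≥0∞) (μ ν : Measure X) : 0 ≤ strongDist κ μ ν :=
  Real.sqrt_nonneg _

lemma memEplus_zero (κ : X → X → ℝ≥0∞) : memEplus κ (0 : Measure X) := by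
  refine ⟨?_, by simp [energy, mutualEnergy]⟩
  unfold IsRadon
  infer_instance

lemma eq_zero_of_energy_eq_zero {κ : X → X → ℝ≥0∞} (hE : EnergyPrinciple κ) {μ : Measure X}
    (hμ : IsRadon μ) (h : energy κ μ = 0) : μ = 0 := by
  have h0 : energy κ (0 : Measure X) = 0 := by simp [energy, mutualEnergy]
  obtain ⟨h1, h2⟩ := hE μ 0 ⟨hμ, by simp [h]⟩ (memEplus_zero κ)
  rw [h, h0, add_zero] at h1 h2
  exact h2 (le_antisymm h1 zero_le)

lemma prod_restrict_le_prod {μ : Measure X} {U : Set X}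
    (hμ : AEMeasurable (fun x => μ.map (Prod.mk x)) μ) (hfin : μ U ≠ ⊤) :
    (μ.restrict U).prod (μ.restrict U) ≤ μ.prod μ := by
  have : IsFiniteMeasure (μ.restrict U) := isFiniteMeasure_restrict.2 hfin
  refine Measure.le_iff.2 fun s hs => ?_
  rw [Measure.prod_apply hs, Measure.prod, Measure.bind_apply hs hμ]
  refine (lintegral_mono' Measure.restrict_le_self le_rfl).trans (lintegral_mono fun x => ?_)
  rw [Measure.map_apply measurable_prodMk_left hs]
  exact Measure.restrict_le_self _

lemma energy_restrict_le {κ : X → X → ℝ≥0∞} (hE : EnergyPrinciple κ) {μ : Measure X}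
    (hμ : IsRadon μ) {U : Set X} (hfin : μ U ≠ ⊤) :
    energy κ (μ.restrict U) ≤ energy κ μ := by
  by_cases h : AEMeasurable (fun x => μ.map (Prod.mk x)) μ
  · exact lintegral_mono' (prod_restrict_le_prod h hfin) le_rfl
  · have h0 : μ.prod μ = 0 := by
      rw [Measure.prod, Measure.bind, Measure.map_of_not_aemeasurable h, Measure.join_zero]
    have h1 : μ = 0 := eq_zero_of_energy_eq_zero hE hμ (by simp [energy, mutualEnergy, h0])
    simp [h1, energy, mutualEnergy]

section
variable {κ : X → X → ℝ≥0∞}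

lemma FiniteEplus.isFiniteMeasure {μ : Measure X} (h : FiniteEplus κ μ) : IsFiniteMeasure μ := h.1

lemma FiniteEplus.regular {μ : Measure X} (h : FiniteEplus κ μ) : μ.Regular := h.2.1

lemma FiniteEplus.mutualEnergy_ne_top (hE : EnergyPrinciple κ) {μ ν : Measure X}
    (hμ : FiniteEplus κ μ) (hν : FiniteEplus κ ν) : mutualEnergy κ μ ν ≠ ⊤ := by
  have h := (hE μ ν hμ.2 hν.2).1
  have h2 : 2 * mutualEnergy κ μ ν < ⊤ := h.trans_lt (ENNReal.add_lt_top.2 ⟨hμ.2.2, hν.2.2⟩)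
  intro h3
  rw [h3] at h2
  simp at h2

variable [T2Space X] [BorelSpace X]

lemma FiniteEplus.restrict (hE : EnergyPrinciple κ) {μ : Measure X} (hμ : FiniteEplus κ μ)
    (s : Set X) : FiniteEplus κ (μ.restrict s) := by
  have := hμ.isFiniteMeasure
  have := hμ.regular
  exact ⟨inferInstance, (inferInstance : (μ.restrict s).Regular),
    (energy_restrict_le hE hμ.2.1 (measure_ne_top μ s)).trans_lt hμ.2.2⟩

lemma mutualEnergy_add_left (hκ : IsKernel κ) (μ₁ μ₂ ν : Measure X) [IsFiniteMeasure μ₁]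
    [IsFiniteMeasure μ₂] [IsFiniteMeasure ν] [μ₁.Regular] [μ₂.Regular] [ν.Regular] :
    mutualEnergy κ (μ₁ + μ₂) ν = mutualEnergy κ μ₁ ν + mutualEnergy κ μ₂ ν := by
  have : (μ₁ + μ₂).InnerRegular := inferInstance
  rw [mutualEnergy_eq_lintegral_potential hκ, mutualEnergy_eq_lintegral_potential hκ,
    mutualEnergy_eq_lintegral_potential hκ, lintegral_add_measure]

lemma mutualEnergy_smul_left (hκ : IsKernel κ) (c : NNReal) (μ ν : Measure X) [IsFiniteMeasure μ]
    [IsFiniteMeasure ν] [μ.Regular] [ν.Regular] :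
    mutualEnergy κ (c • μ) ν = c * mutualEnergy κ μ ν := by
  rw [mutualEnergy_eq_lintegral_potential hκ, mutualEnergy_eq_lintegral_potential hκ,
    lintegral_smul_measure]
  rfl

lemma FiniteEplus.add (hκ : IsKernel κ) (hE : EnergyPrinciple κ) {μ ν : Measure X}
    (hμ : FiniteEplus κ μ) (hν : FiniteEplus κ ν) : FiniteEplus κ (μ + ν) := by
  have := hμ.isFiniteMeasure
  have := hμ.regular
  have := hν.isFiniteMeasure
  have := hν.regular
  have : (μ + ν).InnerRegular := inferInstance
  have hr : (μ + ν).Regular := inferInstance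
  refine ⟨inferInstance, hr, ?_⟩
  unfold energy
  rw [mutualEnergy_add_left hκ, mutualEnergy_comm hκ μ, mutualEnergy_comm hκ ν,
    mutualEnergy_add_left hκ, mutualEnergy_add_left hκ]
  exact ENNReal.add_lt_top.2 ⟨
    ENNReal.add_lt_top.2 ⟨(hμ.mutualEnergy_ne_top hE hμ).lt_top,
      (hν.mutualEnergy_ne_top hE hμ).lt_top⟩,
    ENNReal.add_lt_top.2 ⟨(hμ.mutualEnergy_ne_top hE hν).lt_top,
      (hν.mutualEnergy_ne_top hE hν).lt_top⟩⟩

lemma FiniteEplus.smul (hκ : IsKernel κ) {μ : Measure X} (c : NNReal)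
    (hμ : FiniteEplus κ μ) : FiniteEplus κ (c • μ) := by
  have := hμ.isFiniteMeasure
  have := hμ.regular
  refine ⟨inferInstance, (inferInstance : (c • μ).Regular), ?_⟩
  unfold energy
  rw [mutualEnergy_smul_left hκ, mutualEnergy_comm hκ, mutualEnergy_smul_left hκ]
  exact ENNReal.mul_lt_top (by simp) (ENNReal.mul_lt_top (by simp) hμ.2.2)

lemma realEnergy_comm (hκ : IsKernel κ) {μ ν : Measure X}
    (hμ : FiniteEplus κ μ) (hν : FiniteEplus κ ν) : realEnergy κ μ ν = realEnergy κ ν μ := by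
  have := hμ.isFiniteMeasure
  have := hν.isFiniteMeasure
  rw [realEnergy, mutualEnergy_comm hκ, realEnergy]

lemma realEnergy_add_left (hκ : IsKernel κ) (hE : EnergyPrinciple κ) {μ₁ μ₂ ν : Measure X}
    (h₁ : FiniteEplus κ μ₁) (h₂ : FiniteEplus κ μ₂) (hν : FiniteEplus κ ν) :
    realEnergy κ (μ₁ + μ₂) ν = realEnergy κ μ₁ ν + realEnergy κ μ₂ ν := by
  have := h₁.isFiniteMeasure
  have := h₁.regular
  have := h₂.isFiniteMeasure
  have := h₂.regular
  have := hν.isFiniteMeasure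
  have := hν.regular
  rw [realEnergy, mutualEnergy_add_left hκ, ENNReal.toReal_add (h₁.mutualEnergy_ne_top hE hν)
    (h₂.mutualEnergy_ne_top hE hν)]
  rfl

lemma realEnergy_smul_left (hκ : IsKernel κ) (c : NNReal) {μ ν : Measure X}
    (hμ : FiniteEplus κ μ) (hν : FiniteEplus κ ν) :
    realEnergy κ (c • μ) ν = c * realEnergy κ μ ν := by
  have := hμ.isFiniteMeasure
  have := hμ.regular
  have := hν.isFiniteMeasure
  have := hν.regular
  rw [realEnergy, mutualEnergy_smul_left hκ]
  simp [realEnergy]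

lemma realEnergy_add_smul_self (hκ : IsKernel κ) (hE : EnergyPrinciple κ) {μ ν : Measure X}
    (hμ : FiniteEplus κ μ) (hν : FiniteEplus κ ν) (s t : NNReal) :
    realEnergy κ (s • μ + t • ν) (s • μ + t • ν) =
      s ^ 2 * realEnergy κ μ μ + 2 * s * t * realEnergy κ μ ν + t ^ 2 * realEnergy κ ν ν := by
  have hμ' := hμ.smul hκ s
  have hν' := hν.smul hκ t
  have h := hμ'.add hκ hE hν'
  rw [realEnergy_add_left hκ hE hμ' hν' h, realEnergy_smul_left hκ s hμ h,
    realEnergy_smul_left hκ t hν h, realEnergy_comm hκ hμ h, realEnergy_comm hκ hν h,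
    realEnergy_add_left hκ hE hμ' hν' hμ, realEnergy_add_left hκ hE hμ' hν' hν,
    realEnergy_smul_left hκ s hμ hμ, realEnergy_smul_left hκ t hν hμ,
    realEnergy_smul_left hκ s hμ hν, realEnergy_smul_left hκ t hν hν, realEnergy_comm hκ hν hμ]
  ring

lemma realEnergy_quad_nonneg (hE : EnergyPrinciple κ) {μ ν : Measure X}
    (hμ : FiniteEplus κ μ) (hν : FiniteEplus κ ν) :
    0 ≤ realEnergy κ μ μ + realEnergy κ ν ν - 2 * realEnergy κ μ ν := by
  have h := ENNReal.toReal_mono (ENNReal.add_ne_top.2 ⟨hμ.2.2.ne, hν.2.2.ne⟩) (hE μ ν hμ.2 hν.2).1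
  rw [ENNReal.toReal_mul, ENNReal.toReal_add hμ.2.2.ne hν.2.2.ne] at h
  simp only [realEnergy, energy, ENNReal.toReal_ofNat] at h ⊢
  linarith

lemma eq_of_realEnergy_quad_le_zero (hE : EnergyPrinciple κ) {μ ν : Measure X}
    (hμ : FiniteEplus κ μ) (hν : FiniteEplus κ ν)
    (h : realEnergy κ μ μ + realEnergy κ ν ν - 2 * realEnergy κ μ ν ≤ 0) : μ = ν := by
  refine (hE μ ν hμ.2 hν.2).2 (le_antisymm (hE μ ν hμ.2 hν.2).1 ?_)
  rw [← ENNReal.toReal_le_toReal (ENNReal.add_ne_top.2 ⟨hμ.2.2.ne, hν.2.2.ne⟩)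
    (ENNReal.mul_ne_top (by simp) (hμ.mutualEnergy_ne_top hE hν)), ENNReal.toReal_mul,
    ENNReal.toReal_add hμ.2.2.ne hν.2.2.ne]
  simp only [realEnergy, energy, ENNReal.toReal_ofNat] at h ⊢
  linarith

lemma strongDist_sq (hE : EnergyPrinciple κ) {μ ν : Measure X}
    (hμ : FiniteEplus κ μ) (hν : FiniteEplus κ ν) : strongDist κ μ ν ^ 2 =
      realEnergy κ μ μ + realEnergy κ ν ν - 2 * realEnergy κ μ ν :=
  Real.sq_sqrt (realEnergy_quad_nonneg hE hμ hν)

/-- The Cauchy–Schwarz inequality for the energy form. -/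
lemma abs_realEnergy_sub_le (hκ : IsKernel κ) (hE : EnergyPrinciple κ) {μ ν σ : Measure X}
    (hμ : FiniteEplus κ μ) (hν : FiniteEplus κ ν) (hσ : FiniteEplus κ σ) :
    |realEnergy κ μ σ - realEnergy κ ν σ| ≤ strongDist κ μ ν * √(realEnergy κ σ σ) := by
  have key : ∀ {α β : Measure X}, FiniteEplus κ α → FiniteEplus κ β → ∀ t : NNReal,
      0 ≤ realEnergy κ σ σ * (t * t) + 2 * (realEnergy κ α σ - realEnergy κ β σ) * t
        + (realEnergy κ α α + realEnergy κ β β - 2 * realEnergy κ α β) := by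
    intro α β hα hβ t
    have h1 := realEnergy_add_smul_self hκ hE hα hσ 1 t
    have h2 := realEnergy_quad_nonneg hE ((hα.smul hκ 1).add hκ hE (hσ.smul hκ t)) hβ
    rw [h1, realEnergy_add_left hκ hE (hα.smul hκ 1) (hσ.smul hκ t) hβ,
      realEnergy_smul_left hκ 1 hα hβ, realEnergy_smul_left hκ t hσ hβ,
      realEnergy_comm hκ hσ hβ] at h2
    push_cast at h2
    linarith
  have hd := strongDist_sq hE hμ hν
  have hquad : ∀ t : ℝ, 0 ≤ realEnergy κ σ σ * (t * t)
      + 2 * (realEnergy κ μ σ - realEnergy κ ν σ) * t + strongDist κ μ ν ^ 2 := by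
    intro t
    rw [hd]
    rcases le_total 0 t with ht | ht
    · exact key hμ hν ⟨t, ht⟩
    · have h := key hν hμ ⟨-t, by linarith⟩
      rw [realEnergy_comm hκ hν hμ] at h
      change 0 ≤ _ + _ * -t + _ at h
      change 0 ≤ realEnergy κ σ σ * (-t * -t) + _ * -t + _ at h
      linarith
  have h := discrim_le_zero hquad
  unfold discrim at h
  refine abs_le_of_sq_le_sq ?_ (mul_nonneg (strongDist_nonneg _ _ _) (Real.sqrt_nonneg _))
  rw [mul_pow, Real.sq_sqrt (realEnergy_nonneg _ _ _)]
  nlinarith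

end

section
variable [BorelSpace X]

lemma lowerSemicontinuous_indicator_of_isOpen {U : Set X} (hU : IsOpen U) {g : X → ℝ≥0∞}
    (hg : LowerSemicontinuous g) : LowerSemicontinuous (U.indicator g) := by
  intro x y hy
  by_cases hx : x ∈ U
  · rw [indicator_of_mem hx] at hy
    filter_upwards [hg x y hy, hU.mem_nhds hx] with z hz hzU
    rwa [indicator_of_mem hzU]
  · rw [indicator_of_notMem hx] at hy
    exact absurd hy ENNReal.not_lt_zero

variable (X) in
/-- The relatively compact open sets. -/
abbrev RelCompactOpen := {U : Set X // IsOpen U ∧ IsCompact (closure U)}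

instance : Nonempty (RelCompactOpen X) := ⟨⟨∅, isOpen_empty, by simp⟩⟩

lemma RelCompactOpen.exists_union (U V : RelCompactOpen X) :
    ∃ W : RelCompactOpen X, U.1 ⊆ W.1 ∧ V.1 ⊆ W.1 :=
  ⟨⟨U.1 ∪ V.1, U.2.1.union V.2.1, by rw [closure_union]; exact U.2.2.union V.2.2⟩,
    subset_union_left, subset_union_right⟩

variable [T2Space X] [LocallyCompactSpace X]

lemma iSup_indicator_relCompactOpen (g : X → ℝ≥0∞) (x : X) :
    ⨆ U : RelCompactOpen X, U.1.indicator g x = g x := by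
  refine le_antisymm (iSup_le fun U => indicator_le_self _ _ _) ?_
  obtain ⟨U, hU, hxU, hc⟩ := exists_isOpen_superset_and_isCompact_closure (isCompact_singleton (x := x))
  refine le_iSup_of_le ⟨U, hU, hc⟩ ?_
  rw [indicator_of_mem (hxU rfl)]

lemma lintegral_eq_iSup_relCompactOpen (μ : Measure X) [μ.Regular] {g : X → ℝ≥0∞}
    (hg : LowerSemicontinuous g) :
    ∫⁻ x, g x ∂μ = ⨆ U : RelCompactOpen X, ∫⁻ x in U.1, g x ∂μ := by
  have h := lintegral_iSup_of_directed_lowerSemicontinuous μ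
    (g := fun U : RelCompactOpen X => U.1.indicator g)
    (fun U => lowerSemicontinuous_indicator_of_isOpen U.2.1 hg) (fun U V => by
      obtain ⟨W, h1, h2⟩ := U.exists_union V
      exact ⟨W, indicator_le_indicator_of_subset h1 (fun _ => zero_le),
        indicator_le_indicator_of_subset h2 (fun _ => zero_le)⟩)
  simp only [iSup_indicator_relCompactOpen] at h
  rw [h]
  exact iSup_congr fun U => lintegral_indicator U.2.1.measurableSet g

variable {κ : X → X → ℝ≥0∞}

lemma measure_relCompactOpen_ne_top {μ : Measure X} (hμ : IsRadon μ) (U : RelCompactOpen X) :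
    μ U.1 ≠ ⊤ := by
  have : μ.Regular := hμ
  exact ((measure_mono subset_closure).trans_lt U.2.2.measure_lt_top).ne

lemma finiteEplus_restrict_relCompactOpen (hE : EnergyPrinciple κ) {ϑ : Measure X}
    (hϑ : memEplus κ ϑ) (U : RelCompactOpen X) : FiniteEplus κ (ϑ.restrict U.1) := by
  have : ϑ.Regular := hϑ.1
  have h := measure_relCompactOpen_ne_top hϑ.1 U
  exact ⟨isFiniteMeasure_restrict.2 h, Measure.Regular.restrict_of_measure_ne_top h,
    (energy_restrict_le hE hϑ.1 h).trans_lt hϑ.2⟩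

/-- The integral of the potential of `ϑ` against `μ`. -/
def potentialIntegral (κ : X → X → ℝ≥0∞) (ϑ μ : Measure X) : ℝ≥0∞ := ∫⁻ x, potential κ ϑ x ∂μ

lemma potentialIntegral_eq_iSup (hκ : IsKernel κ) (hE : EnergyPrinciple κ) {ϑ μ : Measure X}
    (hϑ : memEplus κ ϑ) (hμ : FiniteEplus κ μ) :
    potentialIntegral κ ϑ μ = ⨆ U : RelCompactOpen X, mutualEnergy κ μ (ϑ.restrict U.1) := by
  have : ϑ.Regular := hϑ.1
  have := hμ.isFiniteMeasure
  have := hμ.regular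
  have hf := finiteEplus_restrict_relCompactOpen hE hϑ
  have h1 : ∀ x, potential κ ϑ x = ⨆ U : RelCompactOpen X, potential κ (ϑ.restrict U.1) x :=
    fun x => lintegral_eq_iSup_relCompactOpen ϑ (hκ.2.comp (Continuous.prodMk_right x))
  simp only [potentialIntegral, h1]
  rw [lintegral_iSup_of_directed_lowerSemicontinuous μ]
  · refine iSup_congr fun U => ?_
    have := (hf U).isFiniteMeasure
    have := (hf U).regular
    rw [mutualEnergy_eq_lintegral_potential hκ]
  · intro U
    have := (hf U).regular
    exact lowerSemicontinuous_potential hκ _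
  · intro U V
    obtain ⟨W, h1, h2⟩ := U.exists_union V
    exact ⟨W, fun x => lintegral_mono_set h1, fun x => lintegral_mono_set h2⟩

lemma two_mul_potentialIntegral_le (hκ : IsKernel κ) (hE : EnergyPrinciple κ) {ϑ μ : Measure X}
    (hϑ : memEplus κ ϑ) (hμ : FiniteEplus κ μ) :
    2 * potentialIntegral κ ϑ μ ≤ energy κ μ + energy κ ϑ := by
  rw [potentialIntegral_eq_iSup hκ hE hϑ hμ, ENNReal.mul_iSup]
  refine iSup_le fun U => ?_
  refine (hE μ _ hμ.2 (finiteEplus_restrict_relCompactOpen hE hϑ U).2).1.trans ?_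
  gcongr
  exact energy_restrict_le hE hϑ.1 (measure_relCompactOpen_ne_top hϑ.1 U)

lemma potentialIntegral_ne_top (hκ : IsKernel κ) (hE : EnergyPrinciple κ) {ϑ μ : Measure X}
    (hϑ : memEplus κ ϑ) (hμ : FiniteEplus κ μ) : potentialIntegral κ ϑ μ ≠ ⊤ := by
  intro h
  have h2 := (two_mul_potentialIntegral_le hκ hE hϑ hμ).trans_lt
    (ENNReal.add_lt_top.2 ⟨hμ.2.2, hϑ.2⟩)
  rw [h] at h2
  simp at h2

lemma two_mul_toReal_potentialIntegral_le (hκ : IsKernel κ) (hE : EnergyPrinciple κ)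
    {ϑ μ : Measure X} (hϑ : memEplus κ ϑ) (hμ : FiniteEplus κ μ) :
    2 * (potentialIntegral κ ϑ μ).toReal ≤ realEnergy κ μ μ + (energy κ ϑ).toReal := by
  have h := ENNReal.toReal_mono (ENNReal.add_ne_top.2 ⟨hμ.2.2.ne, hϑ.2.ne⟩)
    (two_mul_potentialIntegral_le hκ hE hϑ hμ)
  rwa [ENNReal.toReal_mul, ENNReal.toReal_add hμ.2.2.ne hϑ.2.ne, ENNReal.toReal_ofNat] at h

lemma toReal_potentialIntegral_le_add (hκ : IsKernel κ) (hE : EnergyPrinciple κ)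
    {ϑ μ ν : Measure X} (hϑ : memEplus κ ϑ) (hμ : FiniteEplus κ μ) (hν : FiniteEplus κ ν) :
    (potentialIntegral κ ϑ μ).toReal ≤
      (potentialIntegral κ ϑ ν).toReal + strongDist κ μ ν * √(energy κ ϑ).toReal := by
  have hpos : 0 ≤ strongDist κ μ ν * √(energy κ ϑ).toReal :=
    mul_nonneg (strongDist_nonneg _ _ _) (Real.sqrt_nonneg _)
  have hν' := potentialIntegral_ne_top hκ hE hϑ hν
  have h : potentialIntegral κ ϑ μ ≤ potentialIntegral κ ϑ ν +
      ENNReal.ofReal (strongDist κ μ ν * √(energy κ ϑ).toReal) := by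
    rw [potentialIntegral_eq_iSup hκ hE hϑ hμ]
    refine iSup_le fun U => ?_
    have hU := finiteEplus_restrict_relCompactOpen hE hϑ U
    have h1 := (abs_le.1 (abs_realEnergy_sub_le hκ hE hμ hν hU)).2
    have h2 : √(realEnergy κ (ϑ.restrict U.1) (ϑ.restrict U.1)) ≤ √(energy κ ϑ).toReal :=
      Real.sqrt_le_sqrt (ENNReal.toReal_mono hϑ.2.ne
        (energy_restrict_le hE hϑ.1 (measure_relCompactOpen_ne_top hϑ.1 U)))
    have h3 : mutualEnergy κ ν (ϑ.restrict U.1) ≤ potentialIntegral κ ϑ ν := by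
      rw [potentialIntegral_eq_iSup hκ hE hϑ hν]
      exact le_iSup (fun U : RelCompactOpen X => mutualEnergy κ ν (ϑ.restrict U.1)) U
    refine le_trans ?_ (add_le_add_left h3 _)
    rw [← ENNReal.ofReal_toReal (hμ.mutualEnergy_ne_top hE hU),
      ← ENNReal.ofReal_toReal (hν.mutualEnergy_ne_top hE hU),
      ← ENNReal.ofReal_add ENNReal.toReal_nonneg hpos]
    refine ENNReal.ofReal_le_ofReal ?_
    have h4 := mul_le_mul_of_nonneg_left h2 (strongDist_nonneg κ μ ν)
    simp only [realEnergy] at h1 h4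
    linarith
  have h5 := ENNReal.toReal_mono (ENNReal.add_ne_top.2 ⟨hν', ENNReal.ofReal_ne_top⟩) h
  rwa [ENNReal.toReal_add hν' ENNReal.ofReal_ne_top, ENNReal.toReal_ofReal hpos] at h5

end

/-- A representation of a field as `h - C - U^ϑ` with `h` positive lower semicontinuous, `C` a
positive constant and `ϑ ∈ E⁺`. -/
structure IsFieldRep (κ : X → X → ℝ≥0∞) (f : X → EReal) (h : X → ℝ≥0∞) (C : ℝ)
    (ϑ : Measure X) : Prop where
  lsc : LowerSemicontinuous h
  nonneg : 0 ≤ C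
  mem : memEplus κ ϑ
  eq : ∀ x, f x = ((h x : EReal) - (C : EReal)) - (potential κ ϑ x : EReal)

lemma exists_real_lower_bound {ψ : X → EReal} (hψ : LowerSemicontinuous ψ) (hbot : ∀ x, ψ x ≠ ⊥)
    (hpos : ¬ CompactSpace X → ∀ x, 0 ≤ ψ x) : ∃ C : ℝ, 0 ≤ C ∧ ∀ x, 0 ≤ ψ x + (C : EReal) := by
  by_cases hc : CompactSpace X
  · rcases isEmpty_or_nonempty X with hX | hX
    · exact ⟨0, le_rfl, fun x => hX.elim x⟩
    · obtain ⟨a, -, ha⟩ := LowerSemicontinuousOn.exists_isMinOn (s := (univ : Set X)) univ_nonempty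
        isCompact_univ (hψ.lowerSemicontinuousOn _)
      refine ⟨max 0 (-(ψ a).toReal), le_max_left _ _, fun x => ?_⟩
      have h1 : ψ a ≤ ψ x := isMinOn_iff.1 ha x (mem_univ x)
      have h2 : ((ψ a).toReal : EReal) ≤ ψ a := EReal.coe_toReal_le (hbot a)
      have h3 : (0 : EReal) ≤ ((ψ a).toReal : EReal) + ((max 0 (-(ψ a).toReal) : ℝ) : EReal) := by
        rw [← EReal.coe_add]
        have := le_max_right 0 (-(ψ a).toReal)
        exact EReal.coe_nonneg.2 (by linarith)
      exact h3.trans (add_le_add (h2.trans h1) le_rfl)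
  · exact ⟨0, le_rfl, fun x => by simpa using hpos hc x⟩

section
variable [T2Space X] [LocallyCompactSpace X] [BorelSpace X] {κ : X → X → ℝ≥0∞}

lemma exists_isFieldRep (hκ : IsKernel κ) {f : X → EReal} (hf : IsExternalField κ f) :
    ∃ h C ϑ, IsFieldRep κ f h C ϑ := by
  obtain ⟨ψ, ϑp, ϑm, hψ, hbot, hpos, hp, hm, hfeq⟩ := hf
  obtain ⟨C, hC0, hC⟩ := exists_real_lower_bound hψ hbot hpos
  have : ϑp.Regular := hp.1
  refine ⟨fun x => (ψ x + (C : EReal)).toENNReal + potential κ ϑp x, C, ϑm, ?_, hC0, hm, ?_⟩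
  · refine LowerSemicontinuous.add ?_ (lowerSemicontinuous_potential hκ ϑp)
    have hcont : Continuous fun y : EReal => (y + (C : EReal)).toENNReal := by
      refine EReal.continuous_toENNReal.comp (continuous_iff_continuousAt.2 fun y => ?_)
      exact ContinuousAt.comp (f := fun y : EReal => (y, (C : EReal)))
        (EReal.continuousAt_add (Or.inr (EReal.coe_ne_bot C)) (Or.inr (EReal.coe_ne_top C)))
        (Continuous.prodMk_left _).continuousAt
    exact hcont.comp_lowerSemicontinuous hψ
      (fun a b hab => EReal.toENNReal_le_toENNReal (add_le_add hab le_rfl))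
  · intro x
    rw [hfeq, EReal.coe_ennreal_add, EReal.coe_toENNReal (hC x), add_right_comm,
      EReal.add_sub_cancel_right]

variable {f : X → EReal} {h : X → ℝ≥0∞} {C : ℝ} {ϑ : Measure X}

lemma IsFieldRep.measurable (hκ : IsKernel κ) (hf : IsFieldRep κ f h C ϑ) : Measurable f := by
  have : ϑ.Regular := hf.mem.1
  have h1 : Measurable h := hf.lsc.measurable
  have h2 : Measurable (potential κ ϑ) := (lowerSemicontinuous_potential hκ ϑ).measurable
  have h3 : f = fun x => (((h x : EReal) + -(C : EReal)) + -(potential κ ϑ x : EReal)) :=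
    funext fun x => by rw [hf.eq x, sub_eq_add_neg, sub_eq_add_neg]
  rw [h3]
  exact (h1.coe_ereal_ennreal.add measurable_const).add h2.coe_ereal_ennreal.neg

lemma IsFieldRep.eq_coe (hf : IsFieldRep κ f h C ϑ) {x : X} (hx : h x ≠ ⊤)
    (hx' : potential κ ϑ x ≠ ⊤) :
    f x = (((h x).toReal - C - (potential κ ϑ x).toReal : ℝ) : EReal) := by
  rw [hf.eq x, EReal.coe_sub, EReal.coe_sub]
  lift h x to NNReal using hx with a
  lift potential κ ϑ x to NNReal using hx' with b
  rfl

lemma IsFieldRep.eq_top (hf : IsFieldRep κ f h C ϑ) {x : X} (hx : h x = ⊤)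
    (hx' : potential κ ϑ x ≠ ⊤) : f x = ⊤ := by
  rw [hf.eq x, hx]
  lift potential κ ϑ x to NNReal using hx' with b
  rw [EReal.coe_ennreal_top, EReal.top_sub (EReal.coe_ne_top C)]
  exact EReal.top_sub (by simp)

lemma IsFieldRep.ae_potential_ne_top (hκ : IsKernel κ) (hE : EnergyPrinciple κ)
    (hf : IsFieldRep κ f h C ϑ) {μ : Measure X} (hμ : FiniteEplus κ μ) :
    ∀ᵐ x ∂μ, potential κ ϑ x ≠ ⊤ := by
  have : ϑ.Regular := hf.mem.1
  filter_upwards [ae_lt_top (lowerSemicontinuous_potential hκ ϑ).measurable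
    (potentialIntegral_ne_top hκ hE hf.mem hμ)] with x hx using hx.ne

lemma IsFieldRep.integrable_potential (hκ : IsKernel κ) (hE : EnergyPrinciple κ)
    (hf : IsFieldRep κ f h C ϑ) {μ : Measure X} (hμ : FiniteEplus κ μ) :
    Integrable (fun x => (potential κ ϑ x).toReal) μ := by
  have : ϑ.Regular := hf.mem.1
  exact integrable_toReal_of_lintegral_ne_top
    (lowerSemicontinuous_potential hκ ϑ).measurable.aemeasurable
    (potentialIntegral_ne_top hκ hE hf.mem hμ)

lemma IsFieldRep.fieldIntegrable (hκ : IsKernel κ) (hE : EnergyPrinciple κ)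
    (hf : IsFieldRep κ f h C ϑ) {μ : Measure X} (hμ : FiniteEplus κ μ)
    (hfin : ∫⁻ x, h x ∂μ ≠ ⊤) : FieldIntegrable f μ := by
  have := hμ.isFiniteMeasure
  have hm := hf.lsc.measurable
  have key : ∀ᵐ x ∂μ, f x = (((h x).toReal - C - (potential κ ϑ x).toReal : ℝ) : EReal) := by
    filter_upwards [ae_lt_top hm hfin, hf.ae_potential_ne_top hκ hE hμ] with x h1 h2
    exact hf.eq_coe h1.ne h2
  constructor
  · refine (((integrable_toReal_of_lintegral_ne_top hm.aemeasurable hfin).sub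
      (integrable_const C)).sub (hf.integrable_potential hκ hE hμ)).congr ?_
    filter_upwards [key] with x hx
    rw [hx, EReal.toReal_coe]
    rfl
  · filter_upwards [key] with x hx
    rw [hx]
    exact ⟨EReal.coe_ne_top _, EReal.coe_ne_bot _⟩

lemma IsFieldRep.ae_ne_top (hκ : IsKernel κ) (hE : EnergyPrinciple κ)
    (hf : IsFieldRep κ f h C ϑ) {μ : Measure X} (hμ : FiniteEplus κ μ)
    (hint : FieldIntegrable f μ) : ∀ᵐ x ∂μ, h x ≠ ⊤ := by
  filter_upwards [hint.2, hf.ae_potential_ne_top hκ hE hμ] with x h1 h2 h3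
  exact h1.1 (hf.eq_top h3 h2)

lemma IsFieldRep.lintegral_ne_top (hκ : IsKernel κ) (hE : EnergyPrinciple κ)
    (hf : IsFieldRep κ f h C ϑ) {μ : Measure X} (hμ : FiniteEplus κ μ)
    (hint : FieldIntegrable f μ) : ∫⁻ x, h x ∂μ ≠ ⊤ := by
  have := hμ.isFiniteMeasure
  have h1 : Integrable (fun x => (h x).toReal) μ := by
    refine ((hint.1.add (integrable_const C)).add (hf.integrable_potential hκ hE hμ)).congr ?_
    filter_upwards [hf.ae_ne_top hκ hE hμ hint, hf.ae_potential_ne_top hκ hE hμ] with x h1 h2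
    simp only [Pi.add_apply]
    rw [hf.eq_coe h1 h2, EReal.toReal_coe]
    ring
  have h2 : ∫⁻ x, h x ∂μ = ∫⁻ x, ENNReal.ofReal (h x).toReal ∂μ := by
    refine lintegral_congr_ae ?_
    filter_upwards [hf.ae_ne_top hκ hE hμ hint] with x hx
    rw [ENNReal.ofReal_toReal hx]
  rw [h2]
  exact h1.lintegral_lt_top.ne

lemma IsFieldRep.fieldIntegral_eq (hκ : IsKernel κ) (hE : EnergyPrinciple κ)
    (hf : IsFieldRep κ f h C ϑ) {μ : Measure X} (hμ : FiniteEplus κ μ) (hmass : μ univ = 1)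
    (hint : FieldIntegrable f μ) :
    fieldIntegral f μ = (∫⁻ x, h x ∂μ).toReal - C - (potentialIntegral κ ϑ μ).toReal := by
  have : ϑ.Regular := hf.mem.1
  have : IsProbabilityMeasure μ := ⟨hmass⟩
  have hm := hf.lsc.measurable
  have hfin := hf.lintegral_ne_top hκ hE hμ hint
  have h1 := integrable_toReal_of_lintegral_ne_top hm.aemeasurable hfin
  have hmV : Measurable (potential κ ϑ) := (lowerSemicontinuous_potential hκ ϑ).measurable
  have h2 : fieldIntegral f μ = ∫ x, ((h x).toReal - C - (potential κ ϑ x).toReal) ∂μ := by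
    refine integral_congr_ae ?_
    filter_upwards [hf.ae_ne_top hκ hE hμ hint, hf.ae_potential_ne_top hκ hE hμ] with x h1 h2
    rw [hf.eq_coe h1 h2, EReal.toReal_coe]
  have h3 := hf.integrable_potential hκ hE hμ
  have h4 : Integrable (fun x => (h x).toReal - C) μ := h1.sub (integrable_const C)
  rw [h2, integral_sub h4 h3, integral_sub h1 (integrable_const C),
    integral_toReal hm.aemeasurable (ae_lt_top hm hfin),
    integral_toReal hmV.aemeasurable (ae_lt_top hmV (potentialIntegral_ne_top hκ hE hf.mem hμ))]
  simp [potentialIntegral]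

end

section
variable [T2Space X] [LocallyCompactSpace X] [BorelSpace X]

lemma exists_bump {K V : Set X} (hK : IsCompact K) (hV : IsOpen V) (hKV : K ⊆ V) :
    ∃ φ : X → ℝ, Continuous φ ∧ HasCompactSupport φ ∧
      ∀ μ : Measure X, μ.Regular →
        μ K ≤ ENNReal.ofReal (∫ x, φ x ∂μ) ∧ ENNReal.ofReal (∫ x, φ x ∂μ) ≤ μ V := by
  obtain ⟨φ, h1, h0, hc, h01⟩ := exists_continuous_one_zero_of_isCompact hK hV.isClosed_compl
    (disjoint_left.2 fun x hx hx' => hx' (hKV hx))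
  refine ⟨φ, φ.continuous, hc, fun μ hμ => ?_⟩
  have hint : Integrable φ μ := φ.continuous.integrable_of_hasCompactSupport hc
  rw [ofReal_integral_eq_lintegral_ofReal hint (Eventually.of_forall fun x => (h01 x).1)]
  constructor
  · rw [← lintegral_indicator_one hK.measurableSet]
    refine lintegral_mono fun x => ?_
    by_cases hx : x ∈ K
    · rw [indicator_of_mem hx, h1 hx]
      simp
    · simp [hx]
  · rw [← lintegral_indicator_one hV.measurableSet]
    refine lintegral_mono fun x => ?_
    by_cases hx : x ∈ V
    · rw [indicator_of_mem hx]
      simpa using (h01 x).2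
    · simp [hx, h0 hx]

lemma VagueTendstoSeq.measure_le_liminf {μ : ℕ → Measure X} {μ₀ : Measure X}
    (h : VagueTendstoSeq μ μ₀) (hμ : ∀ n, (μ n).Regular) [μ₀.Regular] {V : Set X}
    (hV : IsOpen V) : μ₀ V ≤ liminf (fun n => μ n V) atTop := by
  rw [hV.measure_eq_iSup_isCompact]
  refine iSup₂_le fun K hKV => iSup_le fun hK => ?_
  obtain ⟨φ, hφ, hc, hb⟩ := exists_bump hK hV hKV
  refine (hb μ₀ inferInstance).1.trans ?_
  rw [← ((ENNReal.continuous_ofReal.tendsto _).comp (h φ hφ hc)).liminf_eq]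
  exact liminf_le_liminf (Eventually.of_forall fun n => (hb (μ n) (hμ n)).2)

lemma VagueTendstoSeq.eventually_measure_lt {μ : ℕ → Measure X} {μ₀ : Measure X}
    (h : VagueTendstoSeq μ μ₀) (hμ : ∀ n, (μ n).Regular) [μ₀.Regular] {K : Set X}
    (hK : IsCompact K) {b : ℝ≥0∞} (hb : μ₀ univ < b) : ∀ᶠ n in atTop, μ n K < b := by
  obtain ⟨φ, hφ, hc, hbd⟩ := exists_bump hK isOpen_univ (subset_univ _)
  have h1 := (ENNReal.continuous_ofReal.tendsto _).comp (h φ hφ hc)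
  filter_upwards [h1.eventually_lt_const ((hbd μ₀ inferInstance).2.trans_lt hb)] with n hn
  exact (hbd (μ n) (hμ n)).1.trans_lt hn

variable {κ : X → X → ℝ≥0∞} {A : Set X}

lemma memBreve.finiteEplus {μ : Measure X} (h : memBreve κ A μ) : FiniteEplus κ μ :=
  ⟨⟨by rw [h.2.2]; exact ENNReal.one_lt_top⟩, h.1⟩

lemma Concentrated.restrict {μ : Measure X} (h : Concentrated μ A) (s : Set X) :
    Concentrated (μ.restrict s) A := fun K hK =>
  le_antisymm ((Measure.restrict_apply_le s _).trans (h K hK).le) zero_le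

lemma Concentrated.smul {μ : Measure X} (h : Concentrated μ A) (c : NNReal) :
    Concentrated (c • μ) A := fun K hK => by
  rw [Measure.smul_apply, h K hK, smul_zero]

lemma Concentrated.add {μ ν : Measure X} (h : Concentrated μ A) (h' : Concentrated ν A) :
    Concentrated (μ + ν) A := fun K hK => by
  rw [Measure.add_apply, h K hK, h' K hK, add_zero]

lemma memBreve_normalize (hκ : IsKernel κ) {μ : Measure X} (hμ : FiniteEplus κ μ)
    (hA : Concentrated μ A) (h0 : μ univ ≠ 0) :
    memBreve κ A ((μ univ).toNNReal⁻¹ • μ) := by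
  have := hμ.isFiniteMeasure
  refine ⟨(hμ.smul hκ _).2, hA.smul _, ?_⟩
  have h1 : ((μ univ).toNNReal : ℝ≥0∞) = μ univ := ENNReal.coe_toNNReal (measure_ne_top _ _)
  have h2 : (μ univ).toNNReal ≠ 0 := fun h => h0 (by rw [← h1, h]; rfl)
  rw [Measure.smul_apply, ENNReal.smul_def, smul_eq_mul, ← h1, ENNReal.toNNReal_coe,
    ← ENNReal.coe_mul, inv_mul_cancel₀ h2, ENNReal.coe_one]

lemma wcap_mul_sq_le (hκ : IsKernel κ) {μ : Measure X} (hμ : FiniteEplus κ μ)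
    (hA : Concentrated μ A) : (wcap κ A).toReal * (μ.real univ) ^ 2 ≤ realEnergy κ μ μ := by
  have := hμ.isFiniteMeasure
  by_cases h0 : μ univ = 0
  · simpa [Measure.real, h0] using realEnergy_nonneg κ μ μ
  have hb := memBreve_normalize hκ hμ hA h0
  have h1 : (wcap κ A).toReal ≤ (energy κ ((μ univ).toNNReal⁻¹ • μ)).toReal :=
    ENNReal.toReal_mono hb.1.2.ne (iInf₂_le _ hb)
  have hpos : 0 < μ.real univ := ENNReal.toReal_pos h0 (measure_ne_top _ _)
  have h2 : (energy κ ((μ univ).toNNReal⁻¹ • μ)).toReal =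
      (μ.real univ)⁻¹ * ((μ.real univ)⁻¹ * realEnergy κ μ μ) := by
    change realEnergy κ _ _ = _
    rw [realEnergy_smul_left hκ _ hμ (hμ.smul hκ _), realEnergy_comm hκ hμ (hμ.smul hκ _),
      realEnergy_smul_left hκ _ hμ hμ]
    rfl
  rw [h2] at h1
  calc (wcap κ A).toReal * (μ.real univ) ^ 2
      ≤ ((μ.real univ)⁻¹ * ((μ.real univ)⁻¹ * realEnergy κ μ μ)) * (μ.real univ) ^ 2 := by gcongr
    _ = realEnergy κ μ μ := by field_simp

variable {μ : ℕ → Measure X} {μ₀ : Measure X}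

lemma tendsto_realEnergy_left (hκ : IsKernel κ) (hE : EnergyPrinciple κ)
    (hμ : ∀ n, FiniteEplus κ (μ n)) (hμ₀ : FiniteEplus κ μ₀) (h : StrongTendstoSeq κ μ μ₀)
    {σ : Measure X} (hσ : FiniteEplus κ σ) :
    Tendsto (fun n => realEnergy κ (μ n) σ) atTop (𝓝 (realEnergy κ μ₀ σ)) := by
  rw [tendsto_iff_dist_tendsto_zero]
  refine squeeze_zero (fun _ => dist_nonneg)
    (fun n => abs_realEnergy_sub_le hκ hE (hμ n) hμ₀ hσ) ?_
  simpa using Tendsto.mul_const (√(realEnergy κ σ σ)) h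

lemma tendsto_realEnergy_self (hκ : IsKernel κ) (hE : EnergyPrinciple κ)
    (hμ : ∀ n, FiniteEplus κ (μ n)) (hμ₀ : FiniteEplus κ μ₀) (h : StrongTendstoSeq κ μ μ₀) :
    Tendsto (fun n => realEnergy κ (μ n) (μ n)) atTop (𝓝 (realEnergy κ μ₀ μ₀)) := by
  have h1 := ((Tendsto.pow h 2).sub_const (realEnergy κ μ₀ μ₀)).add
    ((tendsto_realEnergy_left hκ hE hμ hμ₀ h hμ₀).const_mul 2)
  refine (h1.congr fun n => ?_).trans (le_of_eq (congrArg 𝓝 (by ring)))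
  rw [strongDist_sq hE (hμ n) hμ₀]
  ring

lemma realEnergy_eq_restrict_add (hκ : IsKernel κ) (hE : EnergyPrinciple κ) {α σ : Measure X}
    (hα : FiniteEplus κ α) (hσ : FiniteEplus κ σ) {U : Set X} (hU : MeasurableSet U) :
    realEnergy κ α σ = realEnergy κ (α.restrict U) σ + realEnergy κ (α.restrict Uᶜ) σ := by
  rw [← realEnergy_add_left hκ hE (hα.restrict hE U) (hα.restrict hE Uᶜ) hσ,
    Measure.restrict_add_restrict_compl hU]

end

section
variable [T2Space X] [LocallyCompactSpace X] [BorelSpace X] {κ : X → X → ℝ≥0∞} {A : Set X}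
  {μ : ℕ → Measure X} {μ₀ : Measure X}

lemma realEnergy_restrict_self_le (hκ : IsKernel κ) (hE : EnergyPrinciple κ) {α : Measure X}
    (hα : FiniteEplus κ α) (s : Set X) :
    realEnergy κ (α.restrict s) (α.restrict s) ≤ realEnergy κ α (α.restrict s) := by
  have := hα.isFiniteMeasure
  have := hα.regular
  have hs := hα.restrict hE s
  have := hs.isFiniteMeasure
  have := hs.regular
  refine ENNReal.toReal_mono (hα.mutualEnergy_ne_top hE hs) ?_
  rw [mutualEnergy_eq_lintegral_potential hκ, mutualEnergy_eq_lintegral_potential hκ]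
  exact lintegral_mono' Measure.restrict_le_self le_rfl

/-- The part of the energy of a limit measure carried by a large relatively compact open set is
asymptotically captured by the approximating measures. -/
lemma exists_relCompactOpen_eventually_lt (hκ : IsKernel κ) (hE : EnergyPrinciple κ)
    (hμ : ∀ n, FiniteEplus κ (μ n)) (hμ₀ : FiniteEplus κ μ₀) (hv : VagueTendstoSeq μ μ₀)
    {ε : ℝ} (hε : 0 < ε) : ∃ U : RelCompactOpen X,
      ∀ᶠ n in atTop, realEnergy κ μ₀ μ₀ - ε < realEnergy κ ((μ n).restrict U.1) μ₀ := by
  have := hμ₀.isFiniteMeasure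
  have := hμ₀.regular
  have hlsc := lowerSemicontinuous_potential hκ μ₀
  by_cases hneg : realEnergy κ μ₀ μ₀ - ε < 0
  · exact ⟨Classical.arbitrary _, Eventually.of_forall fun n =>
      hneg.trans_le (realEnergy_nonneg _ _ _)⟩
  push Not at hneg
  have h1 : ENNReal.ofReal (realEnergy κ μ₀ μ₀ - ε) <
      ⨆ U : RelCompactOpen X, ∫⁻ x in U.1, potential κ μ₀ x ∂μ₀ := by
    rw [← lintegral_eq_iSup_relCompactOpen μ₀ hlsc, ← mutualEnergy_eq_lintegral_potential hκ,
      ← ENNReal.ofReal_toReal (hμ₀.mutualEnergy_ne_top hE hμ₀)]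
    refine (ENNReal.ofReal_lt_ofReal_iff_of_nonneg hneg).2 ?_
    simp only [realEnergy]
    linarith
  obtain ⟨U, hU⟩ := lt_iSup_iff.1 h1
  refine ⟨U, ?_⟩
  have h2 : ∫⁻ x, U.1.indicator (potential κ μ₀) x ∂μ₀ ≤
      liminf (fun n => ∫⁻ x, U.1.indicator (potential κ μ₀) x ∂(μ n)) atTop :=
    lintegral_le_liminf_of_lowerSemicontinuous
      (fun V hV => hv.measure_le_liminf (fun n => (hμ n).regular) hV)
      (lowerSemicontinuous_indicator_of_isOpen U.2.1 hlsc)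
  rw [lintegral_indicator U.2.1.measurableSet] at h2
  filter_upwards [eventually_lt_of_lt_liminf (hU.trans_le h2)] with n hn
  have hr := (hμ n).restrict hE U.1
  have := hr.isFiniteMeasure
  have := hr.regular
  rw [lintegral_indicator U.2.1.measurableSet, ← mutualEnergy_eq_lintegral_potential hκ] at hn
  exact (ENNReal.ofReal_lt_iff_lt_toReal hneg (hr.mutualEnergy_ne_top hE hμ₀)).1 hn

lemma measure_univ_eq_one_of_strongTendsto (hκ : IsKernel κ) (hE : EnergyPrinciple κ)
    (hμ : ∀ n, memBreve κ A (μ n)) (hμ₀ : FiniteEplus κ μ₀) (hs : StrongTendstoSeq κ μ μ₀)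
    (hv : VagueTendstoSeq μ μ₀) (hw : wcap κ A ≠ 0) : μ₀ univ = 1 := by
  have := hμ₀.isFiniteMeasure
  have := hμ₀.regular
  have hF : ∀ n, FiniteEplus κ (μ n) := fun n => (hμ n).finiteEplus
  have hle : μ₀ univ ≤ 1 := by
    refine (hv.measure_le_liminf (fun n => (hF n).regular) isOpen_univ).trans ?_
    simp [(hμ _).2.2]
  by_contra hne
  obtain ⟨b, hb0, hb1⟩ := ENNReal.lt_iff_exists_nnreal_btwn.1 (lt_of_le_of_ne hle hne)
  have hb1' : (b : ℝ) < 1 := by exact_mod_cast hb1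
  have hwpos : 0 < (wcap κ A).toReal :=
    ENNReal.toReal_pos hw (((iInf₂_le _ (hμ 0)).trans_lt (hμ 0).1.2).ne)
  set η : ℝ := 1 - b with hη
  have hηpos : 0 < η := by linarith
  set ε : ℝ := (wcap κ A).toReal * η ^ 2 / 8 with hεdef
  have hε : 0 < ε := by positivity
  obtain ⟨U, hU⟩ := exists_relCompactOpen_eventually_lt hκ hE hF hμ₀ hv hε
  have h1 := (tendsto_realEnergy_left hκ hE hF hμ₀ hs hμ₀).eventually_lt_const
    (show realEnergy κ μ₀ μ₀ < realEnergy κ μ₀ μ₀ + ε by linarith)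
  have h2 : Tendsto (fun n => strongDist κ (μ n) μ₀ * √(realEnergy κ (μ n) (μ n))) atTop (𝓝 0) := by
    simpa using Tendsto.mul hs (tendsto_realEnergy_self hκ hE hF hμ₀ hs).sqrt
  have h3 := hv.eventually_measure_lt (fun n => (hF n).regular) U.2.2 hb0
  obtain ⟨n, hUn, h1n, h2n, h3n⟩ := (hU.and (h1.and ((h2.eventually_lt_const hε).and h3))).exists
  have hUm := U.2.1.measurableSet
  have := (hF n).isFiniteMeasure
  have : IsProbabilityMeasure (μ n) := ⟨(hμ n).2.2⟩
  have hτ := (hF n).restrict hE U.1ᶜ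
  have hmass : η ≤ ((μ n).restrict U.1ᶜ).real univ := by
    rw [measureReal_restrict_apply MeasurableSet.univ, univ_inter, probReal_compl_eq_one_sub hUm]
    have h4 : (μ n).real U.1 ≤ b := by
      have := ENNReal.toReal_mono (by simp) ((measure_mono subset_closure).trans h3n.le)
      simpa [Measure.real] using this
    linarith
  have hcap := wcap_mul_sq_le hκ hτ ((hμ n).2.1.restrict _)
  have hself := realEnergy_restrict_self_le hκ hE (hF n) U.1ᶜ
  have hcs := (abs_le.1 (abs_realEnergy_sub_le hκ hE (hF n) hμ₀ hτ)).2
  have hsq : √(realEnergy κ ((μ n).restrict U.1ᶜ) ((μ n).restrict U.1ᶜ)) ≤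
      √(realEnergy κ (μ n) (μ n)) :=
    Real.sqrt_le_sqrt (ENNReal.toReal_mono (hF n).2.2.ne
      (energy_restrict_le hE (hF n).2.1 (measure_ne_top _ _)))
  have hsq' := mul_le_mul_of_nonneg_left hsq (strongDist_nonneg κ (μ n) μ₀)
  have hdec := realEnergy_eq_restrict_add hκ hE (hF n) hμ₀ hUm
  rw [realEnergy_comm hκ hμ₀ hτ] at hcs
  have hfin : (wcap κ A).toReal * η ^ 2 ≤
      (wcap κ A).toReal * ((μ n).restrict U.1ᶜ).real univ ^ 2 := by gcongr
  have : 8 * ε = (wcap κ A).toReal * η ^ 2 := by rw [hεdef]; ring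
  linarith

end

lemma FieldIntegrable.add_smul {f : X → EReal} {μ ν : Measure X} (hμ : FieldIntegrable f μ)
    (hν : FieldIntegrable f ν) (s t : NNReal) : FieldIntegrable f (s • μ + t • ν) := by
  refine ⟨(hμ.1.smul_measure_nnreal).add_measure (hν.1.smul_measure_nnreal), ?_⟩
  rw [ae_add_measure_iff]
  exact ⟨Measure.ae_smul_measure hμ.2 s, Measure.ae_smul_measure hν.2 t⟩

lemma fieldIntegral_add_smul {f : X → EReal} {μ ν : Measure X} (hμ : FieldIntegrable f μ)
    (hν : FieldIntegrable f ν) (s t : NNReal) :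
    fieldIntegral f (s • μ + t • ν) = s * fieldIntegral f μ + t * fieldIntegral f ν := by
  rw [fieldIntegral, integral_add_measure hμ.1.smul_measure_nnreal hν.1.smul_measure_nnreal,
    integral_smul_nnreal_measure, integral_smul_nnreal_measure]
  rfl

section
variable [T2Space X] [LocallyCompactSpace X] [BorelSpace X] {κ : X → X → ℝ≥0∞} {A : Set X}
  {f : X → EReal} {h : X → ℝ≥0∞} {C : ℝ} {ϑ : Measure X}

lemma Admissible.finiteEplus {μ : Measure X} (hμ : Admissible κ A f μ) : FiniteEplus κ μ :=
  hμ.1.finiteEplus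

lemma Admissible.add_smul (hκ : IsKernel κ) (hE : EnergyPrinciple κ) {μ ν : Measure X}
    (hμ : Admissible κ A f μ) (hν : Admissible κ A f ν) {s t : NNReal} (hst : s + t = 1) :
    Admissible κ A f (s • μ + t • ν) := by
  refine ⟨⟨((hμ.finiteEplus.smul hκ s).add hκ hE (hν.finiteEplus.smul hκ t)).2,
    (hμ.1.2.1.smul s).add (hν.1.2.1.smul t), ?_⟩, hμ.2.add_smul hν.2 s t⟩
  rw [Measure.add_apply, Measure.smul_apply, Measure.smul_apply, hμ.1.2.2, hν.1.2.2, ← _root_.add_smul,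
    hst, one_smul]

lemma gaussI_eq (κ : X → X → ℝ≥0∞) (f : X → EReal) (μ : Measure X) :
    gaussI κ f μ = realEnergy κ μ μ + 2 * fieldIntegral f μ := rfl

lemma gaussI_add_smul (hκ : IsKernel κ) (hE : EnergyPrinciple κ) {μ ν : Measure X}
    (hμ : Admissible κ A f μ) (hν : Admissible κ A f ν) (s t : NNReal) :
    gaussI κ f (s • μ + t • ν) = s ^ 2 * realEnergy κ μ μ + 2 * s * t * realEnergy κ μ ν
      + t ^ 2 * realEnergy κ ν ν + 2 * (s * fieldIntegral f μ + t * fieldIntegral f ν) := by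
  rw [gaussI_eq, realEnergy_add_smul_self hκ hE hμ.finiteEplus hν.finiteEplus,
    fieldIntegral_add_smul hμ.2 hν.2]

lemma wf_le_of_admissible {w : ℝ} (hw : wf κ A f = w) {μ : Measure X}
    (hμ : Admissible κ A f μ) : w ≤ gaussI κ f μ := by
  have h : wf κ A f ≤ ((gaussI κ f μ : ℝ) : EReal) := iInf₂_le μ hμ
  rw [hw] at h
  exact EReal.coe_le_coe_iff.1 h

lemma isSolution_of_gaussI_le {w : ℝ} (hw : wf κ A f = w) {μ : Measure X}
    (hμ : Admissible κ A f μ) (h : gaussI κ f μ ≤ w) : IsSolution κ A f μ :=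
  ⟨hμ, by rw [hw, le_antisymm h (wf_le_of_admissible hw hμ)]⟩

lemma IsSolution.gaussI_eq_real {w : ℝ} (hw : wf κ A f = w) {μ : Measure X}
    (hμ : IsSolution κ A f μ) : gaussI κ f μ = w := by
  have h := hμ.2
  rw [hw] at h
  exact EReal.coe_injective h

lemma exists_wf_eq_coe (hκ : IsKernel κ) (hE : EnergyPrinciple κ) (hf : IsFieldRep κ f h C ϑ)
    (hw : wf κ A f < ⊤) : ∃ w : ℝ, wf κ A f = w := by
  have hlow : ((-(2 * C) - (energy κ ϑ).toReal : ℝ) : EReal) ≤ wf κ A f := by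
    refine le_iInf₂ fun μ hμ => EReal.coe_le_coe_iff.2 ?_
    rw [gaussI_eq, hf.fieldIntegral_eq hκ hE hμ.finiteEplus hμ.1.2.2 hμ.2]
    have h1 := two_mul_toReal_potentialIntegral_le hκ hE hf.mem hμ.finiteEplus
    have h2 : 0 ≤ (∫⁻ x, h x ∂μ).toReal := ENNReal.toReal_nonneg
    linarith
  exact ⟨(wf κ A f).toReal, (EReal.coe_toReal hw.ne
    ((EReal.bot_lt_coe _).trans_le hlow).ne').symm⟩

lemma strongDist_sq_le (hκ : IsKernel κ) (hE : EnergyPrinciple κ) {w : ℝ} (hw : wf κ A f = w)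
    {μ ν : Measure X} (hμ : Admissible κ A f μ) (hν : Admissible κ A f ν) :
    strongDist κ μ ν ^ 2 ≤ 2 * gaussI κ f μ + 2 * gaussI κ f ν - 4 * w := by
  have h1 := wf_le_of_admissible hw
    (hμ.add_smul hκ hE hν (s := 2⁻¹) (t := 2⁻¹) (by rw [← two_mul]; exact mul_inv_cancel₀ two_ne_zero))
  rw [gaussI_add_smul hκ hE hμ hν] at h1
  push_cast at h1
  rw [strongDist_sq hE hμ.finiteEplus hν.finiteEplus, gaussI_eq, gaussI_eq]
  linarith

lemma exists_isSolution (hκ : IsKernel κ) (hp : IsPerfect κ) (hclosed : StrongClosedEplusOn κ A)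
    (hf : IsFieldRep κ f h C ϑ) (hcap : wcap κ A ≠ 0) {w : ℝ} (hw : wf κ A f = w) :
    ∃ l, IsSolution κ A f l := by
  obtain ⟨hE, hcomplete, hvague⟩ := hp
  have hmin : ∀ n : ℕ, ∃ μ, Admissible κ A f μ ∧ gaussI κ f μ < w + ((n : ℝ) + 1)⁻¹ := by
    intro n
    have h1 : wf κ A f < ((w + ((n : ℝ) + 1)⁻¹ : ℝ) : EReal) := by
      rw [hw]
      exact EReal.coe_lt_coe_iff.2 (lt_add_of_pos_right _ (by positivity))
    obtain ⟨μ, hμ⟩ := iInf_lt_iff.1 h1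
    obtain ⟨hμ, h2⟩ := iInf_lt_iff.1 hμ
    exact ⟨μ, hμ, EReal.coe_lt_coe_iff.1 h2⟩
  choose μ hμ hlt using hmin
  have hF : ∀ n, FiniteEplus κ (μ n) := fun n => (hμ n).finiteEplus
  have hinv : Tendsto (fun n : ℕ => ((n : ℝ) + 1)⁻¹) atTop (𝓝 0) := by
    simpa using tendsto_one_div_add_atTop_nhds_zero_nat (𝕜 := ℝ)
  have hcauchy : StrongCauchySeq κ μ := by
    intro ε hε
    obtain ⟨N, hN⟩ := eventually_atTop.1 (hinv.eventually_lt_const (show 0 < ε ^ 2 / 4 by positivity))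
    refine ⟨N, fun m hm n hn => lt_of_pow_lt_pow_left₀ 2 hε.le ?_⟩
    have h1 := strongDist_sq_le hκ hE hw (hμ m) (hμ n)
    linarith [hlt m, hlt n, hN m hm, hN n hn]
  obtain ⟨μ₀, hμ₀, hs⟩ := hcomplete μ (fun n => (hF n).2) hcauchy
  have hv := hvague μ μ₀ (fun n => (hF n).2) hμ₀ hs
  have : μ₀.Regular := hμ₀.1
  have hfin : FiniteEplus κ μ₀ := by
    refine ⟨⟨?_⟩, hμ₀⟩
    refine (hv.measure_le_liminf (fun n => (hF n).regular) isOpen_univ).trans_lt ?_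
    simp [(hμ _).1.2.2]
  have hmass := measure_univ_eq_one_of_strongTendsto hκ hE (fun n => (hμ n).1) hfin hs hv hcap
  have hconc := hclosed μ μ₀ (fun n => ⟨(hF n).2, (hμ n).1.2.1⟩) hμ₀ hs
  have hself := tendsto_realEnergy_self hκ hE hF hfin hs
  have hgauss : Tendsto (fun n => gaussI κ f (μ n)) atTop (𝓝 w) := by
    have hup : Tendsto (fun n : ℕ => w + ((n : ℝ) + 1)⁻¹) atTop (𝓝 w) := by
      simpa using hinv.const_add w
    exact tendsto_of_tendsto_of_tendsto_of_le_of_le tendsto_const_nhds hup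
      (fun n => wf_le_of_admissible hw (hμ n)) (fun n => (hlt n).le)
  have hJ : ∀ n, (potentialIntegral κ ϑ (μ n)).toReal ≤ (potentialIntegral κ ϑ μ₀).toReal +
      strongDist κ (μ n) μ₀ * √(energy κ ϑ).toReal :=
    fun n => toReal_potentialIntegral_le_add hκ hE hf.mem (hF n) hfin
  set L : ℝ := (w - realEnergy κ μ₀ μ₀) / 2 + C + (potentialIntegral κ ϑ μ₀).toReal with hL
  set u : ℕ → ℝ := fun n => (gaussI κ f (μ n) - realEnergy κ (μ n) (μ n)) / 2 + C +
    ((potentialIntegral κ ϑ μ₀).toReal + strongDist κ (μ n) μ₀ * √(energy κ ϑ).toReal) with hu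
  have hulim : Tendsto u atTop (𝓝 L) := by
    have h1 := (((hgauss.sub hself).div_const 2).add_const C).add
      ((Tendsto.mul_const (√(energy κ ϑ).toReal) hs).const_add (potentialIntegral κ ϑ μ₀).toReal)
    simpa [hL] using h1
  have hHu : ∀ n, (∫⁻ x, h x ∂(μ n)).toReal ≤ u n := by
    intro n
    simp only [hu]
    rw [gaussI_eq, hf.fieldIntegral_eq hκ hE (hF n) (hμ n).1.2.2 (hμ n).2]
    linarith [hJ n]
  have hH : ∀ n, ∫⁻ x, h x ∂(μ n) ≤ ENNReal.ofReal (u n) := by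
    intro n
    rw [← ENNReal.ofReal_toReal (hf.lintegral_ne_top hκ hE (hF n) (hμ n).2)]
    exact ENNReal.ofReal_le_ofReal (hHu n)
  have hlim := (ENNReal.continuous_ofReal.tendsto _).comp hulim
  have hH₀ : ∫⁻ x, h x ∂μ₀ ≤ ENNReal.ofReal L := by
    refine (lintegral_le_liminf_of_lowerSemicontinuous
      (fun V hV => hv.measure_le_liminf (fun n => (hF n).regular) hV) hf.lsc).trans ?_
    rw [← hlim.liminf_eq]
    exact liminf_le_liminf (Eventually.of_forall hH)
  have hadm : Admissible κ A f μ₀ := ⟨⟨hμ₀, hconc, hmass⟩,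
    hf.fieldIntegrable hκ hE hfin (hH₀.trans_lt ENNReal.ofReal_lt_top).ne⟩
  refine ⟨μ₀, isSolution_of_gaussI_le hw hadm ?_⟩
  have hL0 : 0 ≤ L := ge_of_tendsto' hulim fun n => ENNReal.toReal_nonneg.trans (hHu n)
  have h3 := ENNReal.toReal_mono ENNReal.ofReal_ne_top hH₀
  rw [ENNReal.toReal_ofReal hL0] at h3
  rw [gaussI_eq, hf.fieldIntegral_eq hκ hE hfin hmass hadm.2]
  linarith

end

lemma ae_eq_const_of_ae_le_of_le_integral {μ : Measure X} [IsProbabilityMeasure μ] {g : X → ℝ}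
    {c : ℝ} (hg : Integrable g μ) (hle : ∀ᵐ x ∂μ, g x ≤ c) (h : c ≤ ∫ x, g x ∂μ) :
    ∀ᵐ x ∂μ, g x = c := by
  have hint : Integrable (fun x => c - g x) μ := (integrable_const c).sub hg
  have hnn : 0 ≤ᵐ[μ] fun x => c - g x := by
    filter_upwards [hle] with x hx using sub_nonneg.2 hx
  have h0 : ∫ x, (c - g x) ∂μ = 0 := by
    refine le_antisymm ?_ (integral_nonneg_of_ae hnn)
    rw [integral_sub (integrable_const c) hg]
    simpa using h
  filter_upwards [(integral_eq_zero_iff_of_nonneg_ae hnn hint).1 h0] with x hx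
  simp only [Pi.zero_apply] at hx
  linarith

lemma nearlyEverywhere_iff {κ : X → X → ℝ≥0∞} {A : Set X} {P : X → Prop} :
    NearlyEverywhere κ A P ↔ ∀ ν, ¬ memBreve κ {x ∈ A | ¬ P x} ν := by
  rw [NearlyEverywhere, innerCap, ENNReal.inv_eq_zero]
  constructor
  · intro h ν hν
    have : wcap κ {x ∈ A | ¬ P x} ≤ energy κ ν := iInf₂_le ν hν
    rw [h] at this
    exact hν.1.2.not_ge this
  · intro h
    exact iInf₂_eq_top.2 fun ν hν => absurd hν (h ν)

section
variable [T2Space X] [LocallyCompactSpace X] [BorelSpace X] {κ : X → X → ℝ≥0∞} {A : Set X}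
  {f : X → EReal} {h : X → ℝ≥0∞} {C : ℝ} {ϑ : Measure X}

lemma NearlyEverywhere.ae (hκ : IsKernel κ) (hE : EnergyPrinciple κ) {P : X → Prop}
    (hP : NearlyEverywhere κ A P) (hm : MeasurableSet {x | ¬ P x}) {μ : Measure X}
    (hμ : memBreve κ A μ) : ∀ᵐ x ∂μ, P x := by
  rw [ae_iff]
  by_contra h0
  have hconc : Concentrated (μ.restrict {x | ¬ P x}) {x ∈ A | ¬ P x} := by
    intro K hK
    have hsub : {x ∈ A | ¬ P x}ᶜ ∩ K ⊆ (Aᶜ ∩ K) ∪ {x | ¬ P x}ᶜ := by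
      rintro x ⟨hx, hxK⟩
      by_cases hxA : x ∈ A
      · exact Or.inr fun hxP => hx ⟨hxA, hxP⟩
      · exact Or.inl ⟨hxA, hxK⟩
    refine measure_mono_null hsub (measure_union_null (hμ.2.1.restrict _ K hK) ?_)
    rw [Measure.restrict_apply hm.compl, compl_inter_self, measure_empty]
  exact nearlyEverywhere_iff.1 hP _
    (memBreve_normalize hκ (hμ.finiteEplus.restrict hE _) hconc (by simpa using h0))

lemma Concentrated.measure_eq_zero {μ : Measure X} [IsFiniteMeasure μ] [μ.Regular]
    (hμ : Concentrated μ A) {s : Set X} (hs : MeasurableSet s) (hsA : Disjoint s A) : μ s = 0 := by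
  rw [hs.measure_eq_iSup_isCompact_of_ne_top (measure_ne_top μ s)]
  simp only [ENNReal.iSup_eq_zero]
  intro K hKs hK
  refine measure_mono_null (fun x hx => ?_) (hμ K hK)
  exact ⟨fun hxA => disjoint_left.1 hsA (hKs hx) hxA, hx⟩

lemma Concentrated.mono {μ : Measure X} {B : Set X} (hμ : Concentrated μ A) (h : A ⊆ B) :
    Concentrated μ B := fun K hK =>
  measure_mono_null (inter_subset_inter_left K (compl_subset_compl.2 h)) (hμ K hK)

lemma integrable_toReal_potential (hκ : IsKernel κ) (hE : EnergyPrinciple κ) {μ ν : Measure X}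
    (hμ : FiniteEplus κ μ) (hν : FiniteEplus κ ν) :
    Integrable (fun x => (potential κ μ x).toReal) ν := by
  have := hμ.isFiniteMeasure
  have := hμ.regular
  have := hν.regular
  refine integrable_toReal_of_lintegral_ne_top
    (lowerSemicontinuous_potential hκ μ).measurable.aemeasurable ?_
  rw [← mutualEnergy_eq_lintegral_potential hκ]
  exact hν.mutualEnergy_ne_top hE hμ

lemma ae_potential_lt_top (hκ : IsKernel κ) (hE : EnergyPrinciple κ) {μ ν : Measure X}
    (hμ : FiniteEplus κ μ) (hν : FiniteEplus κ ν) : ∀ᵐ x ∂ν, potential κ μ x < ⊤ := by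
  have := hμ.isFiniteMeasure
  have := hμ.regular
  have := hν.regular
  refine ae_lt_top (lowerSemicontinuous_potential hκ μ).measurable ?_
  rw [← mutualEnergy_eq_lintegral_potential hκ]
  exact hν.mutualEnergy_ne_top hE hμ

lemma integral_toReal_potential (hκ : IsKernel κ) (hE : EnergyPrinciple κ) {μ ν : Measure X}
    (hμ : FiniteEplus κ μ) (hν : FiniteEplus κ ν) :
    ∫ x, (potential κ μ x).toReal ∂ν = realEnergy κ ν μ := by
  have := hμ.isFiniteMeasure
  have := hμ.regular
  have := hν.regular
  rw [integral_toReal (lowerSemicontinuous_potential hκ μ).measurable.aemeasurable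
    (ae_potential_lt_top hκ hE hμ hν), realEnergy, mutualEnergy_eq_lintegral_potential hκ]

lemma ae_wPotential_eq (hκ : IsKernel κ) (hE : EnergyPrinciple κ) {μ ν : Measure X}
    (hμ : FiniteEplus κ μ) (hν : FiniteEplus κ ν) (hf : FieldIntegrable f ν) :
    ∀ᵐ x ∂ν, wPotential κ f μ x =
      (((potential κ μ x).toReal + (f x).toReal : ℝ) : EReal) := by
  filter_upwards [ae_potential_lt_top hκ hE hμ hν, hf.2] with x h1 h2
  rw [wPotential, EReal.coe_add, EReal.coe_toReal h2.1 h2.2]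
  lift potential κ μ x to NNReal using h1.ne with a
  rfl

lemma integrable_toReal_wPotential (hκ : IsKernel κ) (hE : EnergyPrinciple κ) {μ ν : Measure X}
    (hμ : FiniteEplus κ μ) (hν : FiniteEplus κ ν) (hf : FieldIntegrable f ν) :
    Integrable (fun x => (wPotential κ f μ x).toReal) ν := by
  refine ((integrable_toReal_potential hκ hE hμ hν).add hf.1).congr ?_
  filter_upwards [ae_wPotential_eq hκ hE hμ hν hf] with x hx
  rw [hx, EReal.toReal_coe]
  rfl

lemma integral_toReal_wPotential (hκ : IsKernel κ) (hE : EnergyPrinciple κ) {μ ν : Measure X}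
    (hμ : FiniteEplus κ μ) (hν : FiniteEplus κ ν) (hf : FieldIntegrable f ν) :
    ∫ x, (wPotential κ f μ x).toReal ∂ν = realEnergy κ ν μ + fieldIntegral f ν := by
  rw [← integral_toReal_potential hκ hE hμ hν, fieldIntegral,
    ← integral_add (integrable_toReal_potential hκ hE hμ hν) hf.1]
  refine integral_congr_ae ?_
  filter_upwards [ae_wPotential_eq hκ hE hμ hν hf] with x hx
  rw [hx, EReal.toReal_coe]

lemma wConst_eq (hκ : IsKernel κ) (hE : EnergyPrinciple κ) {μ : Measure X}
    (hμ : Admissible κ A f μ) : wConst κ f μ = realEnergy κ μ μ + fieldIntegral f μ :=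
  integral_toReal_wPotential hκ hE hμ.finiteEplus hμ.finiteEplus hμ.2

lemma le_of_ae_le_wPotential (hκ : IsKernel κ) (hE : EnergyPrinciple κ) {μ ν : Measure X}
    (hμ : FiniteEplus κ μ) (hν : Admissible κ A f ν) {c : ℝ}
    (h : ∀ᵐ x ∂ν, (c : EReal) ≤ wPotential κ f μ x) :
    c ≤ realEnergy κ ν μ + fieldIntegral f ν := by
  have : IsProbabilityMeasure ν := ⟨hν.1.2.2⟩
  rw [← integral_toReal_wPotential hκ hE hμ hν.finiteEplus hν.2]
  have h1 : ∫ _, c ∂ν ≤ ∫ x, (wPotential κ f μ x).toReal ∂ν := by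
    refine integral_mono_ae (integrable_const c)
      (integrable_toReal_wPotential hκ hE hμ hν.finiteEplus hν.2) ?_
    filter_upwards [h, ae_wPotential_eq hκ hE hμ hν.finiteEplus hν.2] with x h1 h2
    rw [h2] at h1 ⊢
    exact EReal.coe_le_coe_iff.1 h1
  simpa using h1

lemma le_of_ae_wPotential_le (hκ : IsKernel κ) (hE : EnergyPrinciple κ) {μ ν : Measure X}
    (hμ : FiniteEplus κ μ) (hν : Admissible κ A f ν) {c : ℝ}
    (h : ∀ᵐ x ∂ν, wPotential κ f μ x ≤ (c : EReal)) :
    realEnergy κ ν μ + fieldIntegral f ν ≤ c := by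
  have : IsProbabilityMeasure ν := ⟨hν.1.2.2⟩
  rw [← integral_toReal_wPotential hκ hE hμ hν.finiteEplus hν.2]
  have h1 : ∫ x, (wPotential κ f μ x).toReal ∂ν ≤ ∫ _, c ∂ν := by
    refine integral_mono_ae (integrable_toReal_wPotential hκ hE hμ hν.finiteEplus hν.2)
      (integrable_const c) ?_
    filter_upwards [h, ae_wPotential_eq hκ hE hμ hν.finiteEplus hν.2] with x h1 h2
    rw [h2] at h1 ⊢
    exact EReal.coe_le_coe_iff.1 h1
  simpa using h1

lemma IsFieldRep.measurable_wPotential (hκ : IsKernel κ) (hf : IsFieldRep κ f h C ϑ)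
    {μ : Measure X} (hμ : FiniteEplus κ μ) : Measurable (wPotential κ f μ) := by
  have := hμ.regular
  exact ((lowerSemicontinuous_potential hκ μ).measurable.coe_ereal_ennreal).add (hf.measurable hκ)

/-- The variational inequality satisfied by a solution. -/
lemma IsSolution.variational_le (hκ : IsKernel κ) (hE : EnergyPrinciple κ) {w : ℝ}
    (hw : wf κ A f = w) {l ν : Measure X} (hl : IsSolution κ A f l) (hν : Admissible κ A f ν) :
    realEnergy κ l l + fieldIntegral f l ≤ realEnergy κ ν l + fieldIntegral f ν := by
  have hlF := hl.1.finiteEplus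
  by_contra! hlt
  rw [realEnergy_comm hκ hν.finiteEplus hlF] at hlt
  set D := realEnergy κ l ν + fieldIntegral f ν - realEnergy κ l l - fieldIntegral f l with hD
  set Q := realEnergy κ l l + realEnergy κ ν ν - 2 * realEnergy κ l ν with hQdef
  have hD0 : D < 0 := by linarith
  have hQ : 0 ≤ Q := realEnergy_quad_nonneg hE hlF hν.finiteEplus
  have hQD : 0 < Q - D := by linarith
  have ht0 : 0 < -D / (Q - D) := div_pos (by linarith) hQD
  have ht1 : -D / (Q - D) ≤ 1 := (div_le_one hQD).2 (by linarith)
  have hteq : -D / (Q - D) * (Q - D) = -D := div_mul_cancel₀ _ hQD.ne'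
  generalize -D / (Q - D) = t at ht0 ht1 hteq
  lift t to NNReal using ht0.le
  have hst : (1 - t) + t = 1 := tsub_add_cancel_of_le (by exact_mod_cast ht1)
  have h1 := wf_le_of_admissible hw (hl.1.add_smul hκ hE hν hst)
  rw [gaussI_add_smul hκ hE hl.1 hν, NNReal.coe_sub (by exact_mod_cast ht1), NNReal.coe_one] at h1
  rw [← hl.gaussI_eq_real hw, gaussI_eq] at h1
  have h2 : 0 ≤ t * (2 * D + t * Q) := by
    rw [hD, hQdef]
    linarith
  have h3 : 2 * D + t * Q < 0 := by
    have : t * D < 0 := mul_neg_of_pos_of_neg ht0 hD0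
    linarith
  exact absurd (mul_neg_of_pos_of_neg ht0 h3) (not_lt.2 h2)

lemma IsFieldRep.admissible_of_ae_wPotential_le (hκ : IsKernel κ) (hE : EnergyPrinciple κ)
    (hf : IsFieldRep κ f h C ϑ) {μ ν : Measure X} (hν : memBreve κ A ν) {c : ℝ}
    (hle : ∀ᵐ x ∂ν, wPotential κ f μ x ≤ (c : EReal)) : Admissible κ A f ν := by
  have : IsProbabilityMeasure ν := ⟨hν.2.2⟩
  refine ⟨hν, hf.fieldIntegrable hκ hE hν.finiteEplus (ne_top_of_le_ne_top ?_ (lintegral_mono_ae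
    (g := fun x => ENNReal.ofReal (c + C) + potential κ ϑ x) ?_))⟩
  · rw [lintegral_add_left measurable_const, lintegral_const, measure_univ, mul_one]
    exact ENNReal.add_ne_top.2 ⟨ENNReal.ofReal_ne_top,
      potentialIntegral_ne_top hκ hE hf.mem hν.finiteEplus⟩
  · filter_upwards [hle, hf.ae_potential_ne_top hκ hE hν.finiteEplus] with x h1 h2
    have h3 : f x ≤ (c : EReal) :=
      (le_add_of_nonneg_left (EReal.coe_ennreal_nonneg _)).trans h1
    have h4 : h x ≠ ⊤ := by
      intro h5
      rw [hf.eq_top h5 h2] at h3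
      exact (EReal.coe_lt_top c).not_ge h3
    rw [hf.eq_coe h4 h2, EReal.coe_le_coe_iff] at h3
    rw [← ENNReal.ofReal_toReal h4]
    refine (ENNReal.ofReal_le_ofReal (q := (c + C) + (potential κ ϑ x).toReal) (by linarith)).trans
      (ENNReal.ofReal_add_le.trans ?_)
    rw [ENNReal.ofReal_toReal h2]

lemma IsSolution.nearlyEverywhere_le (hκ : IsKernel κ) (hE : EnergyPrinciple κ)
    (hf : IsFieldRep κ f h C ϑ) {w : ℝ} (hw : wf κ A f = w) {l : Measure X}
    (hl : IsSolution κ A f l) :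
    NearlyEverywhere κ A (fun x => ((wConst κ f l : ℝ) : EReal) ≤ wPotential κ f l x) := by
  refine nearlyEverywhere_iff.2 fun ν hν => ?_
  have : IsProbabilityMeasure ν := ⟨hν.2.2⟩
  have := hν.finiteEplus.regular
  have hlF := hl.1.finiteEplus
  have hmeas := hf.measurable_wPotential hκ hlF
  have hlt : ∀ᵐ x ∂ν, wPotential κ f l x < ((wConst κ f l : ℝ) : EReal) := by
    rw [ae_iff]
    refine hν.2.1.measure_eq_zero (hmeas measurableSet_Iio).compl ?_
    exact disjoint_left.2 fun x hx hx' => hx (not_le.1 hx'.2)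
  have hνA : memBreve κ A ν := ⟨hν.1, hν.2.1.mono (sep_subset _ _), hν.2.2⟩
  have hadm := hf.admissible_of_ae_wPotential_le hκ hE hνA (hlt.mono fun x hx => hx.le)
  have hreal := ae_wPotential_eq hκ hE hlF hν.finiteEplus hadm.2
  have hint := integrable_toReal_wPotential hκ hE hlF hν.finiteEplus hadm.2
  have heq : ∀ᵐ x ∂ν, (wPotential κ f l x).toReal = wConst κ f l := by
    refine ae_eq_const_of_ae_le_of_le_integral hint ?_ ?_
    · filter_upwards [hlt, hreal] with x h1 h2
      rw [h2] at h1 ⊢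
      exact (EReal.coe_lt_coe_iff.1 h1).le
    · rw [integral_toReal_wPotential hκ hE hlF hν.finiteEplus hadm.2, wConst_eq hκ hE hl.1]
      exact hl.variational_le hκ hE hw hadm
  have hfalse : ∀ᵐ x ∂ν, False := by
    filter_upwards [hlt, hreal, heq] with x h1 h2 h3
    rw [h2] at h1 h3
    rw [← h3, EReal.toReal_coe] at h1
    exact lt_irrefl _ h1
  rw [Filter.eventually_false_iff_eq_bot, ae_eq_bot] at hfalse
  exact IsProbabilityMeasure.ne_zero ν hfalse

lemma IsSolution.eq_of_nearlyEverywhere_le (hκ : IsKernel κ) (hE : EnergyPrinciple κ)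
    (hf : IsFieldRep κ f h C ϑ) {w : ℝ} (hw : wf κ A f = w) {l μ : Measure X}
    (hl : IsSolution κ A f l) (hμ : Admissible κ A f μ)
    (hne : NearlyEverywhere κ A (fun x => ((wConst κ f μ : ℝ) : EReal) ≤ wPotential κ f μ x)) :
    μ = l := by
  have hμF := hμ.finiteEplus
  have hlF := hl.1.finiteEplus
  have hm : MeasurableSet {x | ¬ ((wConst κ f μ : ℝ) : EReal) ≤ wPotential κ f μ x} :=
    ((hf.measurable_wPotential hκ hμF) measurableSet_Ici).compl
  have h1 := le_of_ae_le_wPotential hκ hE hμF hl.1 (hne.ae hκ hE hm hl.1.1)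
  rw [wConst_eq hκ hE hμ] at h1
  have h2 := hl.variational_le hκ hE hw hμ
  rw [realEnergy_comm hκ hlF hμF] at h1
  exact eq_of_realEnergy_quad_le_zero hE hμF hlF (by linarith)

lemma IsSolution.wConst_eq_sub (hκ : IsKernel κ) (hE : EnergyPrinciple κ) {w : ℝ}
    (hw : wf κ A f = w) {l : Measure X} (hl : IsSolution κ A f l) :
    wConst κ f l = w - fieldIntegral f l := by
  rw [wConst_eq hκ hE hl.1, ← hl.gaussI_eq_real hw, gaussI_eq]
  ring

lemma IsSolution.ae_wPotential_le (hκ : IsKernel κ) (hE : EnergyPrinciple κ)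
    (hf : IsFieldRep κ f h C ϑ) {w : ℝ} (hw : wf κ A f = w) {l : Measure X}
    (hl : IsSolution κ A f l) :
    ∀ᵐ x ∂l, wPotential κ f l x ≤ ((w - fieldIntegral f l : ℝ) : EReal) := by
  have hlF := hl.1.finiteEplus
  have : IsProbabilityMeasure l := ⟨hl.1.1.2.2⟩
  have hm : MeasurableSet {x | ¬ ((wConst κ f l : ℝ) : EReal) ≤ wPotential κ f l x} :=
    ((hf.measurable_wPotential hκ hlF) measurableSet_Ici).compl
  have hge := (hl.nearlyEverywhere_le hκ hE hf hw).ae hκ hE hm hl.1.1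
  have hreal := ae_wPotential_eq hκ hE hlF hlF hl.1.2
  have hint := integrable_toReal_wPotential hκ hE hlF hlF hl.1.2
  have heq : ∀ᵐ x ∂l, -(wPotential κ f l x).toReal = -wConst κ f l := by
    refine ae_eq_const_of_ae_le_of_le_integral hint.neg ?_ ?_
    · filter_upwards [hge, hreal] with x h1 h2
      rw [h2] at h1 ⊢
      exact neg_le_neg (EReal.coe_le_coe_iff.1 h1)
    · rw [integral_neg]
      exact le_rfl
  filter_upwards [hreal, heq] with x h1 h2
  rw [← hl.wConst_eq_sub hκ hE hw, ← neg_injective h2, h1, EReal.toReal_coe]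

lemma isSolution_of_ae_wPotential_le (hκ : IsKernel κ) (hE : EnergyPrinciple κ) {w : ℝ}
    (hw : wf κ A f = w) {μ : Measure X} (hμ : Admissible κ A f μ)
    (h : ∀ᵐ x ∂μ, wPotential κ f μ x ≤ ((w - fieldIntegral f μ : ℝ) : EReal)) :
    IsSolution κ A f μ := by
  have h1 := le_of_ae_wPotential_le hκ hE hμ.finiteEplus hμ h
  refine isSolution_of_gaussI_le hw hμ ?_
  rw [gaussI_eq]
  linarith

lemma wcap_ne_zero_of_innerCap_ne_top (h : innerCap κ A ≠ ⊤) : wcap κ A ≠ 0 := fun h0 =>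
  h (by rw [innerCap, h0, ENNReal.inv_zero])

end

theorem stmt0 {X : Type*} [TopologicalSpace X] [T2Space X] [LocallyCompactSpace X]
    [MeasurableSpace X] [BorelSpace X]
    (κ : X → X → ℝ≥0∞) (f : X → EReal) (A : Set X)
    (hker : IsKernel κ) (hperf : IsPerfect κ) (hf : IsExternalField κ f)
    (hclosed : StrongClosedEplusOn κ A)
    (hcap : innerCap κ A ≠ ⊤) (hw : wf κ A f < ⊤) :
    (∃! l : Measure X, IsSolution κ A f l) ∧
    ∀ l : Measure X, IsSolution κ A f l →
      -- the equilibrium constant `c_{A,f} = ∫ U_f^l dl` is finite and equals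
      -- `w_f(A) − ∫ f dl`
      ((wConst κ f l : ℝ) : EReal) = wf κ A f - ((fieldIntegral f l : ℝ) : EReal) ∧
      -- `l` satisfies `U_f^l ≥ ∫ U_f^l dl` n.e. on `A`, and is the unique such
      -- measure in `Ĕ⁺_f(A)`
      NearlyEverywhere κ A
        (fun x => ((wConst κ f l : ℝ) : EReal) ≤ wPotential κ f l x) ∧
      (∀ μ : Measure X, Admissible κ A f μ →
        NearlyEverywhere κ A
          (fun x => ((wConst κ f μ : ℝ) : EReal) ≤ wPotential κ f μ x) → μ = l) ∧
      -- `l` satisfies `U_f^l ≤ w_f(A) − ∫ f dl` l-a.e., and is the unique such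
      -- measure in `Ĕ⁺_f(A)`
      (∀ᵐ x ∂l, wPotential κ f l x ≤ wf κ A f - ((fieldIntegral f l : ℝ) : EReal)) ∧
      (∀ μ : Measure X, Admissible κ A f μ →
        (∀ᵐ x ∂μ, wPotential κ f μ x ≤ wf κ A f - ((fieldIntegral f μ : ℝ) : EReal)) →
        μ = l) := by
  have hE := hperf.1
  obtain ⟨h, C, ϑ, hrep⟩ := exists_isFieldRep hker hf
  obtain ⟨w, hweq⟩ := exists_wf_eq_coe hker hE hrep hw
  obtain ⟨l₀, hl₀⟩ := exists_isSolution hker hperf hclosed hrep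
    (wcap_ne_zero_of_innerCap_ne_top hcap) hweq
  refine ⟨⟨l₀, hl₀, fun l hl => hl₀.eq_of_nearlyEverywhere_le hker hE hrep hweq hl.1
    (hl.nearlyEverywhere_le hker hE hrep hweq)⟩, fun l hl => ?_⟩
  have hsub : ∀ μ, wf κ A f - ((fieldIntegral f μ : ℝ) : EReal) =
      ((w - fieldIntegral f μ : ℝ) : EReal) := fun μ => by rw [hweq, EReal.coe_sub]
  simp only [hsub]
  refine ⟨by rw [hl.wConst_eq_sub hker hE hweq], hl.nearlyEverywhere_le hker hE hrep hweq,
    fun μ hμ hne => hl.eq_of_nearlyEverywhere_le hker hE hrep hweq hμ hne,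
    hl.ae_wPotential_le hker hE hrep hweq, fun μ hμ hle => ?_⟩
  have hsol := isSolution_of_ae_wPotential_le hker hE hweq hμ hle
  exact hl.eq_of_nearlyEverywhere_le hker hE hrep hweq hμ
    (hsol.nearlyEverywhere_le hker hE hrep hweq)

end GaussVar
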